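/- arXiv:0903.3289 — 5 statements merged into one kernel-verified Lean document; each statement's English description precedes it below -/
import Mathlib

section
/- Let f be a holomorphic local dynamical system at 0 ∈ ℂ with multiplier a₁ = f'(0) satisfying a₁ ≠ 0 and |a₁| ≠ 1 (hyperbolic fixed point). Then f is holomorphically locally conjugated to its linear part g(z) = a₁z, and the conjugating biholomorphism φ is uniquely determined by the normalization φ'(0) = 1. -/
open Set Filter Topology

/-- `φ` is a biholomorphism from `W₁` onto `W₂` fixing `0` which conjugates the holomorphic
local dynamical system `f₁` (defined on `U₁`) to `f₂` (defined on `U₂`), i.e.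
`f₁ = φ⁻¹ ∘ f₂ ∘ φ` on `W₁ ∩ f₁⁻¹ W₁`. -/
def IsHolConjVia (f₁ : ℂ → ℂ) (U₁ : Set ℂ) (f₂ : ℂ → ℂ) (U₂ : Set ℂ)
    (φ : ℂ → ℂ) (W₁ W₂ : Set ℂ) : Prop :=
  IsOpen W₁ ∧ IsOpen W₂ ∧ (0 : ℂ) ∈ W₁ ∧ (0 : ℂ) ∈ W₂ ∧ W₁ ⊆ U₁ ∧ W₂ ⊆ U₂ ∧
    DifferentiableOn ℂ φ W₁ ∧ Set.BijOn φ W₁ W₂ ∧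
    (∃ ψ : ℂ → ℂ, DifferentiableOn ℂ ψ W₂ ∧ Set.EqOn (ψ ∘ φ) id W₁) ∧
    φ 0 = 0 ∧ ∀ z ∈ W₁, f₁ z ∈ W₁ → φ (f₁ z) = f₂ (φ z)

/-- A function analytic at `0` with multiplier `a` agrees with `z ↦ a * z` up to order two. -/
theorem AnalyticAt.isBigO_sub_deriv_mul {f : ℂ → ℂ} (hf : AnalyticAt ℂ f 0) (hf0 : f 0 = 0) :
    (fun z => f z - deriv f 0 * z) =O[𝓝 0] fun z => z ^ 2 := by
  obtain ⟨s, hs, hfs⟩ : ∃ s ∈ 𝓝 (0 : ℂ), DifferentiableOn ℂ f s :=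
    ⟨{z | AnalyticAt ℂ f z}, hf.eventually_analyticAt,
      fun z hz => hz.differentiableAt.differentiableWithinAt⟩
  have hq : DifferentiableAt ℂ (dslope f 0) 0 :=
    ((Complex.differentiableOn_dslope hs).2 hfs).differentiableAt hs
  have hO := (Asymptotics.isBigO_refl (fun z : ℂ => z) (𝓝 0)).mul hq.isBigO_sub
  refine hO.congr (fun z => ?_) fun z => by ring
  have h := sub_smul_dslope f 0 z
  rw [dslope_same]
  simp only [sub_zero, hf0, smul_eq_mul] at h
  rw [mul_sub, h, mul_comm z]

/-- An attracting, not superattracting, fixed point has a linearizing coordinate. -/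
theorem exists_linearization_of_norm_lt_one {f : ℂ → ℂ} {a : ℂ} (hf : AnalyticAt ℂ f 0)
    (hf0 : f 0 = 0) (ha : deriv f 0 = a) (ha0 : a ≠ 0) (ha1 : ‖a‖ < 1) :
    ∃ φ : ℂ → ℂ, AnalyticAt ℂ φ 0 ∧ φ 0 = 0 ∧ deriv φ 0 = 1 ∧
      ∀ᶠ z in 𝓝 0, φ (f z) = a * φ z := by
  have hpos : 0 < ‖a‖ := norm_pos_iff.2 ha0
  obtain ⟨c, hac, hc⟩ : ∃ c, ‖a‖ < c ∧ c < √‖a‖ :=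
    exists_between (Real.lt_sqrt_of_sq_lt (by nlinarith))
  have hc0 : 0 < c := hpos.trans hac
  have hc2 : c ^ 2 < ‖a‖ := (Real.lt_sqrt hc0.le).1 hc
  have hc1 : c < 1 := by nlinarith
  obtain ⟨C, hC, hCb⟩ := (hf.isBigO_sub_deriv_mul hf0).exists_pos
  have hlin : ∀ᶠ z in 𝓝 (0 : ℂ), ‖f z‖ ≤ c * ‖z‖ := by
    have h := hf.differentiableAt.hasDerivAt.isLittleO.def (sub_pos.2 hac)
    filter_upwards [h] with z hz
    simp only [hf0, ha, sub_zero, smul_eq_mul] at hz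
    have h3 : ‖f z‖ ≤ ‖f z - z * a‖ + ‖z * a‖ := by
      simpa using norm_add_le (f z - z * a) (z * a)
    rw [norm_mul] at h3
    linarith
  obtain ⟨r, hr, hball⟩ := Metric.eventually_nhds_iff_ball.1
    (hf.eventually_analyticAt.and (hCb.bound.and hlin))
  have hmaps : MapsTo f (Metric.ball 0 r) (Metric.ball 0 r) := fun z hz => by
    have := (hball z hz).2.2
    rw [mem_ball_zero_iff] at hz ⊢
    nlinarith [norm_nonneg z]
  have hiter (n : ℕ) : MapsTo f^[n] (Metric.ball 0 r) (Metric.ball 0 r) := hmaps.iterate n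
  have hbound (n : ℕ) (z : ℂ) (hz : z ∈ Metric.ball 0 r) : ‖f^[n] z‖ ≤ c ^ n * ‖z‖ := by
    induction n with
    | zero => simp
    | succ n ih =>
      rw [Function.iterate_succ_apply', pow_succ']
      have := (hball _ (hiter n hz)).2.2
      nlinarith
  have hdiff : DifferentiableOn ℂ f (Metric.ball 0 r) := fun z hz =>
    (hball z hz).1.differentiableAt.differentiableWithinAt
  have hdiffn (n : ℕ) : DifferentiableOn ℂ f^[n] (Metric.ball 0 r) := hdiff.iterate hmaps n
  set u : ℕ → ℂ → ℂ := fun n z => (a ^ (n + 1))⁻¹ * (f (f^[n] z) - a * f^[n] z) with hu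
  have hub (n : ℕ) (z : ℂ) (hz : z ∈ Metric.ball 0 r) :
      ‖u n z‖ ≤ (c ^ 2 / ‖a‖) ^ n * (C / ‖a‖ * ‖z‖ ^ 2) := by
    have h1 := (hball _ (hiter n hz)).2.1
    rw [ha, norm_pow] at h1
    have h2 : ‖f^[n] z‖ ^ 2 ≤ (c ^ n * ‖z‖) ^ 2 := by gcongr; exact hbound n z hz
    calc ‖u n z‖ = (‖a‖ ^ (n + 1))⁻¹ * ‖f (f^[n] z) - a * f^[n] z‖ := by simp [hu]
      _ ≤ (‖a‖ ^ (n + 1))⁻¹ * (C * (c ^ n * ‖z‖) ^ 2) := by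
        gcongr
        exact h1.trans (by gcongr)
      _ = _ := by
        rw [div_pow]
        field_simp
        ring
  have hgeom : Summable fun n : ℕ => (c ^ 2 / ‖a‖) ^ n :=
    summable_geometric_of_lt_one (by positivity) ((div_lt_one hpos).2 hc2)
  have hsum (z : ℂ) (hz : z ∈ Metric.ball 0 r) : Summable fun n => u n z :=
    (hgeom.mul_right _).of_norm_bounded fun n => hub n z hz
  have hdS : DifferentiableOn ℂ (fun z => ∑' n, u n z) (Metric.ball 0 r) := by
    refine Complex.differentiableOn_tsum_of_summable_norm (hgeom.mul_right (C / ‖a‖ * r ^ 2))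
      (fun n => ?_) Metric.isOpen_ball fun n z hz => (hub n z hz).trans ?_
    · exact ((hdiff.comp (hdiffn n) (hiter n)).sub ((hdiffn n).const_mul a)).const_mul _
    · rw [mem_ball_zero_iff] at hz
      gcongr
  have hball0 : Metric.ball (0 : ℂ) r ∈ 𝓝 0 := Metric.ball_mem_nhds 0 hr
  have hfix (n : ℕ) : f^[n] 0 = 0 := Function.iterate_fixed hf0 n
  have hS0 : ∑' n, u n 0 = 0 := by simp [hu, hfix, hf0]
  have hSO : (fun z => ∑' n, u n z) =O[𝓝 0] fun z => ‖z - 0‖ ^ 2 := by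
    refine Asymptotics.IsBigO.of_bound ((∑' n : ℕ, (c ^ 2 / ‖a‖) ^ n) * (C / ‖a‖)) ?_
    filter_upwards [hball0] with z hz
    refine (tsum_of_norm_bounded (hgeom.mul_right _).hasSum fun n => hub n z hz).trans ?_
    rw [tsum_mul_right]
    simp [mul_assoc]
  have hS' : HasDerivAt (fun z => ∑' n, u n z) 0 0 := by
    have h := hSO.hasFDerivAt (𝕜 := ℂ) one_lt_two
    simpa using h.hasDerivAt
  have hφ' : HasDerivAt (fun z => z + ∑' n, u n z) 1 0 := by
    simpa using (hasDerivAt_id' (0 : ℂ)).fun_add hS'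
  refine ⟨fun z => z + ∑' n, u n z, (differentiableOn_id.add hdS).analyticAt hball0,
    by simp [hS0], hφ'.deriv, ?_⟩
  filter_upwards [hball0] with z hz
  have hshift (n : ℕ) : u n (f z) = a * u (n + 1) z := by
    simp only [hu, Function.iterate_succ_apply]
    field_simp
    ring
  have h0 : u 0 z = a⁻¹ * (f z - a * z) := by simp [hu]
  simp only [hshift]
  rw [tsum_mul_left, (hsum z hz).tsum_eq_zero_add, h0]
  field_simp
  ring

/-- A hyperbolic fixed point of nonzero multiplier has a linearizing coordinate. -/
theorem exists_linearization_of_norm_ne_one {f : ℂ → ℂ} {a : ℂ} (hf : AnalyticAt ℂ f 0)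
    (hf0 : f 0 = 0) (ha : deriv f 0 = a) (ha0 : a ≠ 0) (ha1 : ‖a‖ ≠ 1) :
    ∃ φ : ℂ → ℂ, AnalyticAt ℂ φ 0 ∧ φ 0 = 0 ∧ deriv φ 0 = 1 ∧
      ∀ᶠ z in 𝓝 0, φ (f z) = a * φ z := by
  rcases ha1.lt_or_gt with h | h
  · exact exists_linearization_of_norm_lt_one hf hf0 ha ha0 h
  have hd : deriv f 0 ≠ 0 := ha ▸ ha0
  set g := hf.hasStrictDerivAt.localInverse _ _ _ hd with hg
  have hgl : ∀ᶠ z in 𝓝 0, g (f z) = z := HasStrictDerivAt.eventually_left_inverse ..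
  have hga : AnalyticAt ℂ g 0 := by simpa only [hf0] using hf.analyticAt_localInverse hd
  have hg0 : g 0 = 0 := by simpa only [hf0] using hgl.self_of_nhds
  have hg' : deriv g 0 = a⁻¹ := by
    have h := (hf.hasStrictDerivAt.to_localInverse hd).hasDerivAt.deriv
    rwa [hf0, ← hg, ha] at h
  obtain ⟨φ, hφ, hφ0, hφ1, hφg⟩ := exists_linearization_of_norm_lt_one hga hg0 hg'
    (inv_ne_zero ha0) (by rw [norm_inv]; exact inv_lt_one_of_one_lt₀ h)
  refine ⟨φ, hφ, hφ0, hφ1, ?_⟩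
  have hft : Tendsto f (𝓝 0) (𝓝 0) := by simpa only [ContinuousAt, hf0] using hf.continuousAt
  filter_upwards [hgl, hft.eventually hφg] with z hz1 hz2
  rw [hz1] at hz2
  rw [hz2, mul_inv_cancel_left₀ ha0]

/-- An analytic function with nonzero derivative at a point restricts to a biholomorphism from
an arbitrarily small open neighbourhood of this point. -/
theorem AnalyticAt.exists_bijOn_of_deriv_ne_zero {φ : ℂ → ℂ} {x : ℂ} (hφ : AnalyticAt ℂ φ x)
    (hd : deriv φ x ≠ 0) {V : Set ℂ} (hV : V ∈ 𝓝 x) :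
    ∃ W₁ W₂ : Set ℂ, IsOpen W₁ ∧ IsOpen W₂ ∧ x ∈ W₁ ∧ φ x ∈ W₂ ∧ W₁ ⊆ V ∧
      DifferentiableOn ℂ φ W₁ ∧ BijOn φ W₁ W₂ ∧
      ∃ ψ : ℂ → ℂ, DifferentiableOn ℂ ψ W₂ ∧ EqOn (ψ ∘ φ) id W₁ := by
  have hstr := hφ.hasStrictDerivAt.hasStrictFDerivAt_equiv hd
  let e := hstr.toOpenPartialHomeomorph φ
  have hgood : ∀ᶠ z in 𝓝 x, z ∈ V ∧ AnalyticAt ℂ φ z ∧ deriv φ z ≠ 0 :=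
    Filter.Eventually.and hV
      (hφ.eventually_analyticAt.and (hφ.deriv.continuousAt.eventually_ne hd))
  obtain ⟨s, hs, hso, hxs⟩ := eventually_nhds_iff.1 hgood
  let e' := e.restrOpen s hso
  have hx : x ∈ e'.source := ⟨hstr.mem_toOpenPartialHomeomorph_source, hxs⟩
  refine ⟨e'.source, e'.target, e'.open_source, e'.open_target, hx, e'.map_source hx,
    fun z hz => (hs z hz.2).1,
    fun z hz => (hs z hz.2).2.1.differentiableAt.differentiableWithinAt, e'.bijOn,
    e'.symm, fun w hw => ?_, fun z hz => e'.left_inv hz⟩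
  obtain ⟨-, han, hne⟩ := hs _ (e'.map_target hw).2
  exact (e'.hasDerivAt_symm hw hne han.differentiableAt.hasDerivAt).differentiableAt
    |>.differentiableWithinAt

/-- Near a hyperbolic fixed point of multiplier `a ≠ 0`, an analytic solution of Schröder's
equation `h ∘ f = a h` that vanishes to order two vanishes identically. -/
theorem eventually_eq_zero_of_comp_eq_mul {f h : ℂ → ℂ} {a : ℂ} (hf : AnalyticAt ℂ f 0)
    (hf0 : f 0 = 0) (ha : deriv f 0 = a) (ha0 : a ≠ 0) (ha1 : ‖a‖ ≠ 1)
    (hh : AnalyticAt ℂ h 0) (hh0 : h 0 = 0) (hh1 : deriv h 0 = 0)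
    (heq : ∀ᶠ z in 𝓝 0, h (f z) = a * h z) : ∀ᶠ z in 𝓝 0, h z = 0 := by
  by_contra hne
  obtain ⟨n, k, hk, hk0, hhk⟩ := hh.exists_eventuallyEq_pow_smul_nonzero_iff.2 hne
  simp only [sub_zero, smul_eq_mul] at hhk
  have hft : Tendsto f (𝓝 0) (𝓝 0) := by simpa only [ContinuousAt, hf0] using hf.continuousAt
  have hlim : a ^ n * k 0 = a * k 0 := by
    have hq : Tendsto (dslope f 0) (𝓝[≠] 0) (𝓝 a) := by
      have hc : ContinuousAt (dslope f 0) 0 := continuousAt_dslope_same.2 hf.differentiableAt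
      rw [ContinuousAt, dslope_same, ha] at hc
      exact hc.mono_left nhdsWithin_le_nhds
    have h1 : Tendsto (fun z => dslope f 0 z ^ n * k (f z)) (𝓝[≠] 0) (𝓝 (a ^ n * k 0)) :=
      (hq.pow n).mul ((hk.continuousAt.tendsto.comp hft).mono_left nhdsWithin_le_nhds)
    have h2 : Tendsto (fun z => a * k z) (𝓝[≠] 0) (𝓝 (a * k 0)) :=
      (hk.continuousAt.tendsto.const_mul a).mono_left nhdsWithin_le_nhds
    refine tendsto_nhds_unique (h1.congr' ?_) h2
    filter_upwards [nhdsWithin_le_nhds heq, nhdsWithin_le_nhds hhk,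
      nhdsWithin_le_nhds (hft.eventually hhk), self_mem_nhdsWithin] with z hz1 hz2 hz3 hz
    have hfz := sub_smul_dslope f 0 z
    simp only [sub_zero, hf0, smul_eq_mul] at hfz
    have hzn : z ^ n ≠ 0 := pow_ne_zero n hz
    refine mul_left_cancel₀ hzn ?_
    rw [← mul_assoc, ← mul_pow, hfz, ← hz3, hz1, hz2]
    ring
  have han : a ^ n = a := mul_right_cancel₀ hk0 hlim
  match n, hhk, han with
  | 0, hhk, _ => exact hk0 (by simpa [hh0] using hhk.self_of_nhds.symm)
  | 1, hhk, _ =>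
    have hd : HasDerivAt (fun z => z ^ 1 * k z) (k 0) 0 := by
      simpa using (hasDerivAt_id' (0 : ℂ)).fun_mul hk.differentiableAt.hasDerivAt
    exact hk0 (hd.deriv.symm.trans ((EventuallyEq.deriv_eq hhk).symm.trans hh1))
  | m + 2, _, han =>
    have : a ^ (m + 1) = 1 := mul_right_cancel₀ ha0 (by rw [← pow_succ, han, one_mul])
    have hnorm : ‖a‖ ^ (m + 1) = 1 := by rw [← norm_pow, this, norm_one]
    exact ha1 ((pow_eq_one_iff_of_nonneg (norm_nonneg a) m.succ_ne_zero).1 hnorm)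

/-- A holomorphic conjugation to a linear map solves Schröder's equation near `0`. -/
theorem IsHolConjVia.analyticAt_and_eventually_comp_eq_mul {f φ : ℂ → ℂ} {U W₁ W₂ : Set ℂ}
    {a : ℂ} (h : IsHolConjVia f U (fun z => a * z) Set.univ φ W₁ W₂)
    (hf : ContinuousAt f 0) (hf0 : f 0 = 0) :
    AnalyticAt ℂ φ 0 ∧ φ 0 = 0 ∧ ∀ᶠ z in 𝓝 0, φ (f z) = a * φ z := by
  obtain ⟨hW, -, h0, -, -, -, hd, -, -, hφ0, hconj⟩ := h
  have hW0 := hW.mem_nhds h0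
  refine ⟨hd.analyticAt hW0, hφ0, ?_⟩
  have hft : ∀ᶠ z in 𝓝 0, f z ∈ W₁ := hf.eventually_mem (by rwa [hf0])
  filter_upwards [hW0, hft] with z hz1 hz2 using hconj z hz1 hz2

/-- **Kœnigs' theorem, part (i).** A one-dimensional holomorphic local dynamical system with a
hyperbolic fixed point at the origin (multiplier `a₁` with `a₁ ≠ 0`, `|a₁| ≠ 1`) is
holomorphically locally conjugated to its linear part `z ↦ a₁ z`; the conjugation is uniquely
determined (as a germ at `0`) by the normalization `φ'(0) = 1`. -/
theorem koenigs_linearization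
    (f : ℂ → ℂ) (U : Set ℂ) (hU : IsOpen U) (h0 : (0 : ℂ) ∈ U)
    (hf : DifferentiableOn ℂ f U) (hf0 : f 0 = 0) (hfne : ∃ z ∈ U, f z ≠ z)
    (a₁ : ℂ) (ha₁ : a₁ = deriv f 0) (ha₁0 : a₁ ≠ 0) (ha₁1 : ‖a₁‖ ≠ 1) :
    (∃ φ W₁ W₂, IsHolConjVia f U (fun z => a₁ * z) Set.univ φ W₁ W₂ ∧ deriv φ 0 = 1) ∧
      ∀ φ W₁ W₂ φ' W₁' W₂',
        IsHolConjVia f U (fun z => a₁ * z) Set.univ φ W₁ W₂ → deriv φ 0 = 1 →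
        IsHolConjVia f U (fun z => a₁ * z) Set.univ φ' W₁' W₂' → deriv φ' 0 = 1 →
        ∀ᶠ z in 𝓝 (0 : ℂ), φ z = φ' z := by
  have hfa : AnalyticAt ℂ f 0 := hf.analyticAt (hU.mem_nhds h0)
  constructor
  · obtain ⟨φ, hφ, hφ0, hφ1, hconj⟩ :=
      exists_linearization_of_norm_ne_one hfa hf0 ha₁.symm ha₁0 ha₁1
    obtain ⟨W₁, W₂, hW₁, hW₂, h1, h2, hsub, hd, hbij, hinv⟩ :=
      hφ.exists_bijOn_of_deriv_ne_zero (by rw [hφ1]; exact one_ne_zero)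
        (inter_mem (hU.mem_nhds h0) hconj)
    rw [hφ0] at h2
    exact ⟨φ, W₁, W₂, ⟨hW₁, hW₂, h1, h2, fun z hz => (hsub hz).1, subset_univ _, hd, hbij, hinv,
      hφ0, fun z hz _ => (hsub hz).2⟩, hφ1⟩
  · intro φ W₁ W₂ φ' W₁' W₂' h hφ1 h' hφ1'
    obtain ⟨hφ, hφ0, hconj⟩ := h.analyticAt_and_eventually_comp_eq_mul hfa.continuousAt hf0
    obtain ⟨hφ', hφ0', hconj'⟩ := h'.analyticAt_and_eventually_comp_eq_mul hfa.continuousAt hf0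
    have hzero : ∀ᶠ z in 𝓝 0, (φ - φ') z = 0 := by
      refine eventually_eq_zero_of_comp_eq_mul hfa hf0 ha₁.symm ha₁0 ha₁1 (hφ.sub hφ')
        (by simp [hφ0, hφ0']) ?_ ?_
      · rw [deriv_sub hφ.differentiableAt hφ'.differentiableAt, hφ1, hφ1', sub_self]
      · filter_upwards [hconj, hconj'] with z hz hz'
        simp only [Pi.sub_apply, hz, hz', mul_sub]
    filter_upwards [hzero] with z hz using sub_eq_zero.1 hz
end

section
/- Let f be a holomorphic local dynamical system at 0 ∈ ℂ with a superattracting fixed point of order r ≥ 2, i.e. f(z) = a_r z^r + a_{r+1} z^{r+1} + ⋯ with a_r ≠ 0. Then f is holomorphically locally conjugated to the map g(z) = z^r, and the conjugation is unique up to multiplication by an (r−1)-th root of unity: if φ and ψ are two local biholomorphisms fixing 0 that conjugate f to g, then ψ = aφ for some a ∈ ℂ with a^{r−1} = 1. -/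
open Set Filter Topology

/-- The cohomological equation `s * u = g + u ∘ f` has a holomorphic solution on any open set
mapped to itself by `f` on which `g` is bounded, provided that `1 < s`. -/
theorem exists_differentiableOn_mul_eq_add_comp {f g : ℂ → ℂ} {B : Set ℂ} (hB : IsOpen B)
    (hf : DifferentiableOn ℂ f B) (hg : DifferentiableOn ℂ g B) (hmaps : MapsTo f B B)
    {C : ℝ} (hgC : ∀ z ∈ B, ‖g z‖ ≤ C) {s : ℝ} (hs : 1 < s) :
    ∃ u : ℂ → ℂ, DifferentiableOn ℂ u B ∧ ∀ z ∈ B, s * u z = g z + u (f z) := by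
  have hs0 : (s : ℂ) ≠ 0 := by exact_mod_cast (by positivity : s ≠ 0)
  have hiter : ∀ k, MapsTo f^[k] B B := fun k => hmaps.iterate k
  have hditer : ∀ k, DifferentiableOn ℂ f^[k] B := by
    intro k
    induction k with
    | zero => exact differentiableOn_id
    | succ k ih => exact ih.comp hf hmaps
  have hsum : Summable fun k : ℕ => (s⁻¹) ^ (k + 1) * C :=
    (((summable_nat_add_iff 1).2 (summable_geometric_of_lt_one (by positivity)
      (inv_lt_one_of_one_lt₀ hs)))).mul_right C
  have hbound : ∀ k : ℕ, ∀ z ∈ B,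
      ‖((s : ℂ)⁻¹) ^ (k + 1) * g (f^[k] z)‖ ≤ (s⁻¹) ^ (k + 1) * C := by
    intro k z hz
    rw [norm_mul, norm_pow, norm_inv, Complex.norm_real, Real.norm_of_nonneg (by positivity)]
    exact mul_le_mul_of_nonneg_left (hgC _ (hiter k hz)) (by positivity)
  refine ⟨fun z => ∑' k : ℕ, ((s : ℂ)⁻¹) ^ (k + 1) * g (f^[k] z), ?_, ?_⟩
  · exact Complex.differentiableOn_tsum_of_summable_norm hsum
      (fun k => (hg.comp (hditer k) (hiter k)).const_mul _) hB hbound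
  · intro z hz
    have hsz : Summable fun k : ℕ => ((s : ℂ)⁻¹) ^ (k + 1) * g (f^[k] z) :=
      Summable.of_norm_bounded hsum fun k => hbound k z hz
    dsimp only
    rw [hsz.tsum_eq_zero_add, mul_add, ← tsum_mul_left]
    congr 1
    · simp [hs0]
    · refine tsum_congr fun k => ?_
      rw [Function.iterate_succ_apply, pow_succ' _ (k + 1)]
      field_simp

/-- A function holomorphic near `a` with non-zero derivative at `a` restricts to a biholomorphism
from some open neighbourhood of `a`, contained in a prescribed one, onto an open set. -/
theorem exists_isOpen_bijOn_differentiableOn_leftInverse {φ : ℂ → ℂ} {B : Set ℂ} {a : ℂ}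
    (hB : IsOpen B) (haB : a ∈ B) (hφ : DifferentiableOn ℂ φ B) (hφa : deriv φ a ≠ 0) :
    ∃ W₁ W₂ : Set ℂ, IsOpen W₁ ∧ IsOpen W₂ ∧ a ∈ W₁ ∧ W₁ ⊆ B ∧ BijOn φ W₁ W₂ ∧
      ∃ ψ : ℂ → ℂ, DifferentiableOn ℂ ψ W₂ ∧ EqOn (ψ ∘ φ) id W₁ := by
  have hstrict : HasStrictDerivAt φ (deriv φ a) a :=
    (hφ.analyticAt (hB.mem_nhds haB)).hasStrictDerivAt
  let e := (hstrict.hasStrictFDerivAt_equiv hφa).toOpenPartialHomeomorph φ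
  have he : ∀ z, e z = φ z := fun _ => rfl
  have hae : a ∈ e.source :=
    (hstrict.hasStrictFDerivAt_equiv hφa).mem_toOpenPartialHomeomorph_source
  have hopen : IsOpen (B ∩ {z | deriv φ z ≠ 0}) :=
    (hφ.deriv hB).continuousOn.isOpen_inter_preimage hB isOpen_ne
  refine ⟨e.source ∩ (B ∩ {z | deriv φ z ≠ 0}), e '' (e.source ∩ (B ∩ {z | deriv φ z ≠ 0})),
    e.open_source.inter hopen, e.isOpen_image_source_inter hopen, ⟨hae, haB, hφa⟩,
    fun z hz => hz.2.1, (e.injOn.mono inter_subset_left).bijOn_image, e.symm, ?_,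
    fun z hz => e.left_inv hz.1⟩
  rintro _ ⟨z, ⟨hze, hzB, hz⟩, rfl⟩
  refine (e.hasDerivAt_symm (e.map_source hze) hz ?_).differentiableAt.differentiableWithinAt
  rw [e.left_inv hze]
  exact (hφ.differentiableAt (hB.mem_nhds hzB)).hasDerivAt

/-- Local form of a holomorphic germ `f(z) = z ^ r * h(z)`: near `0` it equals
`c ^ (r - 1) * z ^ r * exp (g z)` for a bounded holomorphic `g`, on an invariant ball. -/
theorem exists_ball_eq_mul_exp {f : ℂ → ℂ} {r : ℕ} (hr : 2 ≤ r) (hf : AnalyticAt ℂ f 0)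
    (hord : analyticOrderAt f 0 = r) {U : Set ℂ} (hU : U ∈ 𝓝 0) :
    ∃ c : ℂ, c ≠ 0 ∧ ∃ g : ℂ → ℂ, ∃ ε > 0, Metric.ball 0 ε ⊆ U ∧
      DifferentiableOn ℂ g (Metric.ball 0 ε) ∧ (∀ z ∈ Metric.ball 0 ε, ‖g z‖ ≤ 1) ∧
      MapsTo f (Metric.ball 0 ε) (Metric.ball 0 ε) ∧
      ∀ z ∈ Metric.ball 0 ε, f z = c ^ (r - 1) * z ^ r * Complex.exp (g z) := by
  obtain ⟨h, hh, hh0, hfh⟩ := hf.analyticOrderAt_eq_natCast.1 hord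
  simp only [sub_zero, smul_eq_mul] at hfh
  obtain ⟨c, hc⟩ := IsAlgClosed.exists_pow_nat_eq (h 0) (n := r - 1) (by omega)
  have hg : AnalyticAt ℂ (fun z => Complex.log (h z / h 0)) 0 :=
    (hh.div_const).clog (by simp [hh0])
  have hg1 : ∀ᶠ z in 𝓝 0, ‖Complex.log (h z / h 0)‖ < 1 :=
    hg.continuousAt.norm.eventually_lt_const (by simp [hh0])
  have hsmall : ∀ᶠ z in 𝓝 0, ‖z ^ (r - 1) * h z‖ < 1 :=
    ((continuous_pow (r - 1)).continuousAt.mul hh.continuousAt).norm.eventually_lt_const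
      (by simp [show r - 1 ≠ 0 by omega])
  obtain ⟨ε, hε, hball⟩ := Metric.eventually_nhds_iff_ball.1
    (hfh.and <| hg.eventually_analyticAt.and <| hg1.and <| hsmall.and <|
      (hh.continuousAt.eventually_ne hh0).and hU)
  refine ⟨c, ?_, _, ε, hε, fun z hz => (hball z hz).2.2.2.2.2,
    fun z hz => (hball z hz).2.1.differentiableAt.differentiableWithinAt,
    fun z hz => (hball z hz).2.2.1.le, fun z hz => ?_, fun z hz => ?_⟩
  · rintro rfl
    exact hh0 (by rw [← hc, zero_pow (by omega)])
  · obtain ⟨hfz, -, -, hz1, -⟩ := hball z hz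
    rw [mem_ball_zero_iff] at hz ⊢
    have : f z = z * (z ^ (r - 1) * h z) := by
      rw [hfz, ← mul_assoc, ← pow_succ', Nat.sub_add_cancel (by omega)]
    rw [this, norm_mul]
    exact (mul_le_of_le_one_right (norm_nonneg z) hz1.le).trans_lt hz
  · obtain ⟨hfz, -, -, -, hhz, -⟩ := hball z hz
    rw [hfz, Complex.exp_log (div_ne_zero hhz hh0), hc]
    field_simp

/-- Existence part of Böttcher's theorem. -/
theorem exists_isHolConjVia_pow {f : ℂ → ℂ} {U : Set ℂ} {r : ℕ} (hr : 2 ≤ r) (hU : U ∈ 𝓝 0)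
    (hf : DifferentiableOn ℂ f U) (hord : analyticOrderAt f 0 = r) :
    ∃ φ W₁ W₂, IsHolConjVia f U (fun z => z ^ r) Set.univ φ W₁ W₂ := by
  obtain ⟨c, hc, g, ε, hε, hBU, hg, hg1, hmaps, hfg⟩ :=
    exists_ball_eq_mul_exp hr (hf.analyticAt hU) hord hU
  have h0B : (0 : ℂ) ∈ Metric.ball (0 : ℂ) ε := Metric.mem_ball_self hε
  obtain ⟨u, hu, huf⟩ := exists_differentiableOn_mul_eq_add_comp Metric.isOpen_ball
    (hf.mono hBU) hg hmaps hg1 (s := r) (by exact_mod_cast hr)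
  have hφ : DifferentiableOn ℂ (fun z => z * (c * Complex.exp (u z))) (Metric.ball 0 ε) :=
    differentiableOn_id.mul (hu.cexp.const_mul c)
  have hφ0 : deriv (fun z => z * (c * Complex.exp (u z))) 0 ≠ 0 := by
    have hd := (hu.differentiableAt (Metric.ball_mem_nhds 0 hε)).cexp.const_mul c
    rw [deriv_fun_mul differentiableAt_fun_id hd]
    simpa using hc
  obtain ⟨W₁, W₂, hW₁, hW₂, h0W, hWB, hbij, hinv⟩ :=
    exists_isOpen_bijOn_differentiableOn_leftInverse Metric.isOpen_ball h0B hφ hφ0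
  refine ⟨_, W₁, W₂, hW₁, hW₂, h0W, by simpa using hbij.mapsTo h0W, hWB.trans hBU,
    subset_univ _, hφ.mono hWB, hbij, hinv, by simp, fun z hz _ => ?_⟩
  have hexp : Complex.exp (u z) ^ r = Complex.exp (g z) * Complex.exp (u (f z)) := by
    rw [← Complex.exp_nat_mul, ← Complex.exp_add, ← huf z (hWB hz), Complex.ofReal_natCast]
  have hcr : c ^ r = c ^ (r - 1) * c := by rw [← pow_succ, Nat.sub_add_cancel (by omega)]
  simp only [mul_pow]
  rw [hexp, hcr]
  nth_rewrite 1 [hfg z (hWB hz)]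
  ring

/-- A germ of continuous function `q` with `q ∘ f = q ^ r` near `0` and `q 0 = 1` is
constant, if `r ≥ 2` and `f` does not increase the modulus. -/
theorem eventually_eq_one_of_comp_eq_pow {f q : ℂ → ℂ} {r : ℕ} (hr : 2 ≤ r)
    (hf : ∀ᶠ z in 𝓝 0, ‖f z‖ ≤ ‖z‖) (hq : ∀ᶠ z in 𝓝 0, ContinuousAt q z) (hq0 : q 0 = 1)
    (hqf : ∀ᶠ z in 𝓝 0, q (f z) = q z ^ r) : ∀ᶠ z in 𝓝 0, q z = 1 := by
  have hk : ∀ᶠ z in 𝓝 0, 3 / 2 < ‖∑ i ∈ Finset.range r, q z ^ i‖ := by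
    have hc : ContinuousAt (fun z => ‖∑ i ∈ Finset.range r, q z ^ i‖) 0 :=
      (tendsto_finsetSum _ fun i _ => (hq.self_of_nhds.pow i)).norm
    refine hc.eventually_const_lt ?_
    have : (2 : ℝ) ≤ r := by exact_mod_cast hr
    simp only [hq0, one_pow, Finset.sum_const, Finset.card_range, nsmul_eq_mul, mul_one,
      Complex.norm_natCast]
    linarith
  obtain ⟨ε, hε, hball⟩ := Metric.nhds_basis_closedBall.eventually_iff.1
    (hf.and (hq.and (hqf.and hk)))
  obtain ⟨w, hw, hmax⟩ := (isCompact_closedBall (0 : ℂ) ε).exists_isMaxOn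
    (f := fun z => ‖q z - 1‖) ⟨0, Metric.mem_closedBall_self hε.le⟩
    (fun z hz => ((hball hz).2.1.sub continuousAt_const).norm.continuousWithinAt)
  obtain ⟨hfw, -, hqw, hkw⟩ := hball hw
  have hfw' : f w ∈ Metric.closedBall (0 : ℂ) ε := by
    rw [mem_closedBall_zero_iff] at hw ⊢
    exact hfw.trans hw
  have hle : ‖q (f w) - 1‖ ≤ ‖q w - 1‖ := hmax hfw'
  rw [hqw, ← geom_sum_mul, norm_mul] at hle
  have hw0 : ‖q w - 1‖ ≤ 0 := by nlinarith [norm_nonneg (q w - 1)]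
  filter_upwards [Metric.closedBall_mem_nhds (0 : ℂ) hε] with z hz
  have : ‖q z - 1‖ ≤ 0 := (hmax hz).trans hw0
  exact sub_eq_zero.1 (norm_le_zero_iff.1 this)

/-- The properties of a conjugacy that only depend on its germ at the origin. -/
theorem IsHolConjVia.germ {f₁ f₂ φ : ℂ → ℂ} {U₁ U₂ W₁ W₂ : Set ℂ}
    (h : IsHolConjVia f₁ U₁ f₂ U₂ φ W₁ W₂) (hf : ContinuousAt f₁ 0) (hf0 : f₁ 0 = 0) :
    AnalyticAt ℂ φ 0 ∧ φ 0 = 0 ∧ deriv φ 0 ≠ 0 ∧ ∀ᶠ z in 𝓝 0, φ (f₁ z) = f₂ (φ z) := by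
  obtain ⟨hW₁, hW₂, h0W₁, h0W₂, -, -, hφ, -, ⟨χ, hχ, hχφ⟩, hφ0, hconj⟩ := h
  have hφa := hφ.analyticAt (hW₁.mem_nhds h0W₁)
  refine ⟨hφa, hφ0, fun hd => ?_, ?_⟩
  · have hχ0 : HasDerivAt χ (deriv χ (φ 0)) (φ 0) :=
      (hχ.differentiableAt (hW₂.mem_nhds (hφ0.symm ▸ h0W₂))).hasDerivAt
    have h1 := hχ0.comp (0 : ℂ) hφa.differentiableAt.hasDerivAt
    have h2 : HasDerivAt (χ ∘ φ) 1 0 :=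
      (hasDerivAt_id (0 : ℂ)).congr_of_eventuallyEq
        (hχφ.eventuallyEq_of_mem (hW₁.mem_nhds h0W₁))
    simpa [hd] using h1.unique h2
  · have hpre : ∀ᶠ z in 𝓝 0, f₁ z ∈ W₁ := hf.eventually_mem (hf0.symm ▸ hW₁.mem_nhds h0W₁)
    filter_upwards [hW₁.mem_nhds h0W₁, hpre] with z hz hfz using hconj z hz hfz

theorem AnalyticAt.dslope_self {φ : ℂ → ℂ} {a : ℂ} (hφ : AnalyticAt ℂ φ a) :
    AnalyticAt ℂ (dslope φ a) a := by
  obtain ⟨s, hs, hd⟩ := hφ.eventually_analyticAt.exists_mem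
  exact ((Complex.differentiableOn_dslope hs).2 fun z hz =>
    (hd z hz).differentiableAt.differentiableWithinAt).analyticAt hs

/-- Uniqueness part of Böttcher's theorem, at the level of germs. -/
theorem exists_root_of_unity_eventually_eq_mul {f φ ψ : ℂ → ℂ} {r : ℕ} (hr : 2 ≤ r)
    (hf : AnalyticAt ℂ f 0) (hf0 : f 0 = 0) (hfz : ∀ᶠ z in 𝓝[≠] 0, f z ≠ 0)
    (hfle : ∀ᶠ z in 𝓝 0, ‖f z‖ ≤ ‖z‖)
    (hφ : AnalyticAt ℂ φ 0) (hφ0 : φ 0 = 0) (hφd : deriv φ 0 ≠ 0)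
    (hφf : ∀ᶠ z in 𝓝 0, φ (f z) = φ z ^ r)
    (hψ : AnalyticAt ℂ ψ 0) (hψ0 : ψ 0 = 0) (hψd : deriv ψ 0 ≠ 0)
    (hψf : ∀ᶠ z in 𝓝 0, ψ (f z) = ψ z ^ r) :
    ∃ a : ℂ, a ^ (r - 1) = 1 ∧ ∀ᶠ z in 𝓝 0, ψ z = a * φ z := by
  set q : ℂ → ℂ := fun z => dslope ψ 0 z / dslope φ 0 z with hq
  have hφd' : dslope φ 0 0 ≠ 0 := by rwa [dslope_same]
  have hqa : AnalyticAt ℂ q 0 := hψ.dslope_self.div hφ.dslope_self hφd'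
  have hq_ne : ∀ z, z ≠ 0 → q z = ψ z / φ z := by
    intro z hz
    simp only [hq, dslope_of_ne _ hz, slope_def_field, hφ0, hψ0, sub_zero]
    exact div_div_div_cancel_right₀ hz _ _
  have hqf : ∀ᶠ z in 𝓝[≠] 0, q (f z) = q z ^ r := by
    filter_upwards [hfz, self_mem_nhdsWithin, hφf.filter_mono nhdsWithin_le_nhds,
      hψf.filter_mono nhdsWithin_le_nhds] with z hfz hz h1 h2
    rw [hq_ne _ hfz, hq_ne z hz, h1, h2, div_pow]
  have hqc : ContinuousAt (fun z => q (f z)) 0 :=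
    ContinuousAt.comp (g := q) (by rw [hf0]; exact hqa.continuousAt) hf.continuousAt
  have hq0r : q 0 = q 0 ^ r := by
    have h1 : Tendsto (fun z => q (f z)) (𝓝[≠] 0) (𝓝 (q 0)) := by
      simpa only [hf0] using hqc.tendsto.mono_left nhdsWithin_le_nhds
    have h2 : Tendsto (fun z => q z ^ r) (𝓝[≠] 0) (𝓝 (q 0 ^ r)) :=
      (hqa.continuousAt.pow r).tendsto.mono_left nhdsWithin_le_nhds
    exact tendsto_nhds_unique (h1.congr' hqf) h2
  have hq0 : q 0 ≠ 0 := div_ne_zero (by rwa [dslope_same]) hφd'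
  have hroot : q 0 ^ (r - 1) = 1 := by
    refine mul_right_cancel₀ hq0 ?_
    rw [← pow_succ, Nat.sub_add_cancel (by omega), one_mul, ← hq0r]
  have hqf' : ∀ᶠ z in 𝓝 0, q (f z) = q z ^ r := by
    filter_upwards [eventually_nhdsWithin_iff.1 hqf] with z hz
    rcases eq_or_ne z 0 with rfl | hne
    · rwa [hf0]
    · exact hz hne
  have hone := eventually_eq_one_of_comp_eq_pow (q := fun z => q z / q 0) hr hfle
    (hqa.eventually_analyticAt.mono fun z hz => hz.continuousAt.div_const _) (div_self hq0)
    (by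
      filter_upwards [hqf'] with z hz
      rw [hz, div_pow (q z), ← hq0r])
  refine ⟨q 0, hroot, ?_⟩
  filter_upwards [hone, hφ.dslope_self.continuousAt.eventually_ne hφd'] with z hz hne
  rcases eq_or_ne z 0 with rfl | hz0
  · simp [hφ0, hψ0]
  · have hφz : φ z ≠ 0 := by
      intro h
      exact hne (by rw [dslope_of_ne _ hz0, slope_def_field, h, hφ0]; simp)
    rw [← (div_eq_one_iff_eq hq0).1 hz, hq_ne z hz0, div_mul_cancel₀ _ hφz]

/-- **Böttcher's theorem.** A one-dimensional holomorphic local dynamical system with a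
superattracting fixed point of order `r ≥ 2` at the origin (i.e. `f(z) = a_r z^r + ⋯` with
`a_r ≠ 0`, encoded through the vanishing of the first `r - 1` Taylor coefficients at `0` and the
non-vanishing of the `r`-th one) is holomorphically locally conjugated to `z ↦ z^r`, and the
conjugation is unique up to multiplication by an `(r-1)`-th root of unity. -/
theorem boettcher_superattracting
    (f : ℂ → ℂ) (U : Set ℂ) (hU : IsOpen U) (h0 : (0 : ℂ) ∈ U)
    (hf : DifferentiableOn ℂ f U) (hf0 : f 0 = 0) (hfne : ∃ z ∈ U, f z ≠ z)
    (r : ℕ) (hr : 2 ≤ r)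
    (hvanish : ∀ k, k < r → iteratedDeriv k f 0 = 0)
    (hlead : iteratedDeriv r f 0 ≠ 0) :
    (∃ φ W₁ W₂, IsHolConjVia f U (fun z => z ^ r) Set.univ φ W₁ W₂) ∧
      ∀ φ W₁ W₂ ψ V₁ V₂,
        IsHolConjVia f U (fun z => z ^ r) Set.univ φ W₁ W₂ →
        IsHolConjVia f U (fun z => z ^ r) Set.univ ψ V₁ V₂ →
        ∃ a : ℂ, a ^ (r - 1) = 1 ∧ ∀ᶠ z in 𝓝 (0 : ℂ), ψ z = a * φ z := by
  have hU0 : U ∈ 𝓝 0 := hU.mem_nhds h0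
  have hfa : AnalyticAt ℂ f 0 := hf.analyticAt hU0
  have hord : analyticOrderAt f 0 = r :=
    (analyticOrderAt_eq_nat_iff_iteratedDeriv_eq_zero hfa).2 ⟨hvanish, hlead⟩
  refine ⟨exists_isHolConjVia_pow hr hU0 hf hord, ?_⟩
  intro φ W₁ W₂ ψ V₁ V₂ hφ hψ
  obtain ⟨hφa, hφ0, hφd, hφf⟩ := hφ.germ hfa.continuousAt hf0
  obtain ⟨hψa, hψ0, hψd, hψf⟩ := hψ.germ hfa.continuousAt hf0
  have hfz : ∀ᶠ z in 𝓝[≠] 0, f z ≠ 0 := by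
    refine hfa.eventually_eq_zero_or_eventually_ne_zero.resolve_left fun h => ?_
    rw [analyticOrderAt_eq_top.2 h] at hord
    exact ENat.top_ne_natCast r hord
  have hfle : ∀ᶠ z in 𝓝 0, ‖f z‖ ≤ ‖z‖ := by
    have hd : deriv f 0 = 0 := by simpa using hvanish 1 (by omega)
    have hlo := (hfa.differentiableAt.hasDerivAt).isLittleO
    simpa [hd, hf0] using hlo.bound one_pos
  exact exists_root_of_unity_eventually_eq_mul hr hfa hf0 hfz hfle
    hφa hφ0 hφd hφf hψa hψ0 hψd hψf
end

section
/- Two holomorphic local dynamical systems at 0 ∈ ℂ, each with a superattracting fixed point at the origin, are holomorphically locally conjugated if and only if they are topologically locally conjugated, if and only if they have the same order. In particular, z ↦ z^r and z ↦ z^s are topologically locally conjugated at 0 if and only if r = s. -/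
open Set Filter Topology

/-- `f₁` and `f₂` are holomorphically locally conjugated at `0`. -/
def HolLocallyConj (f₁ : ℂ → ℂ) (U₁ : Set ℂ) (f₂ : ℂ → ℂ) (U₂ : Set ℂ) : Prop :=
  ∃ φ W₁ W₂, IsHolConjVia f₁ U₁ f₂ U₂ φ W₁ W₂

/-- `φ` is a homeomorphism from `W₁` onto `W₂` fixing `0` which conjugates `f₁` to `f₂`. -/
def IsTopConjVia (f₁ : ℂ → ℂ) (U₁ : Set ℂ) (f₂ : ℂ → ℂ) (U₂ : Set ℂ)
    (φ : ℂ → ℂ) (W₁ W₂ : Set ℂ) : Prop :=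
  IsOpen W₁ ∧ IsOpen W₂ ∧ (0 : ℂ) ∈ W₁ ∧ (0 : ℂ) ∈ W₂ ∧ W₁ ⊆ U₁ ∧ W₂ ⊆ U₂ ∧
    ContinuousOn φ W₁ ∧ Set.BijOn φ W₁ W₂ ∧
    (∃ ψ : ℂ → ℂ, ContinuousOn ψ W₂ ∧ Set.EqOn (ψ ∘ φ) id W₁) ∧
    φ 0 = 0 ∧ ∀ z ∈ W₁, f₁ z ∈ W₁ → φ (f₁ z) = f₂ (φ z)

/-- `f₁` and `f₂` are topologically locally conjugated at `0`. -/
def TopLocallyConj (f₁ : ℂ → ℂ) (U₁ : Set ℂ) (f₂ : ℂ → ℂ) (U₂ : Set ℂ) : Prop :=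
  ∃ φ W₁ W₂, IsTopConjVia f₁ U₁ f₂ U₂ φ W₁ W₂

/-- `φ` and `ψ` are mutually inverse germs of homeomorphisms at `0`, and `φ` conjugates the germ
of `f` to the germ of `g`. -/
structure IsGermConj (f g φ ψ : ℂ → ℂ) : Prop where
  tendsto : Tendsto φ (𝓝 0) (𝓝 0)
  tendsto_inv : Tendsto ψ (𝓝 0) (𝓝 0)
  left_inv : ∀ᶠ z in 𝓝 0, ψ (φ z) = z
  right_inv : ∀ᶠ z in 𝓝 0, φ (ψ z) = z
  semiconj : ∀ᶠ z in 𝓝 0, φ (f z) = g (φ z)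

namespace IsGermConj

variable {f g h φ ψ φ' ψ' : ℂ → ℂ}

lemma symm (H : IsGermConj f g φ ψ) (hf : Tendsto f (𝓝 0) (𝓝 0)) : IsGermConj g f ψ φ where
  tendsto := H.tendsto_inv
  tendsto_inv := H.tendsto
  left_inv := H.right_inv
  right_inv := H.left_inv
  semiconj := by
    filter_upwards [H.right_inv, H.tendsto_inv.eventually H.semiconj,
      (hf.comp H.tendsto_inv).eventually H.left_inv] with z h₁ h₂ h₃
    rw [h₁] at h₂
    rw [← h₂]
    exact h₃

lemma trans (H : IsGermConj f g φ ψ) (H' : IsGermConj g h φ' ψ') :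
    IsGermConj f h (φ' ∘ φ) (ψ ∘ ψ') where
  tendsto := H'.tendsto.comp H.tendsto
  tendsto_inv := H.tendsto_inv.comp H'.tendsto_inv
  left_inv := by
    filter_upwards [H.left_inv, H.tendsto.eventually H'.left_inv] with z h₁ h₂
    simp [h₁, h₂]
  right_inv := by
    filter_upwards [H'.right_inv, H'.tendsto_inv.eventually H.right_inv] with z h₁ h₂
    simp [h₁, h₂]
  semiconj := by
    filter_upwards [H.semiconj, H.tendsto.eventually H'.semiconj] with z h₁ h₂
    simp [h₁, h₂]

/-- A conjugacy from `z ↦ z ^ r` to `z ↦ z ^ s` maps the `r` preimages of a point injectively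
into the preimages of its image. -/
lemma le_of_pow {r s : ℕ} (hr : 0 < r) (hs : 0 < s)
    (H : IsGermConj (fun z ↦ z ^ r) (fun z ↦ z ^ s) φ ψ) : r ≤ s := by
  obtain ⟨ε, hε, hball⟩ := Metric.eventually_nhds_iff.1 (H.left_inv.and H.semiconj)
  have hζ := Complex.isPrimitiveRoot_exp r hr.ne'
  set ζ := Complex.exp (2 * Real.pi * Complex.I / r)
  obtain ⟨u, hu0, hu⟩ : ∃ u : ℂ, u ≠ 0 ∧ ‖u‖ < ε :=
    ⟨(ε / 2 : ℝ), by exact_mod_cast (half_pos hε).ne', by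
      rw [Complex.norm_of_nonneg (half_pos hε).le]; exact half_lt_self hε⟩
  have hmem (j : ℕ) : dist (ζ ^ j * u) 0 < ε := by
    simpa [norm_pow, hζ.norm'_eq_one hr.ne'] using hu
  have hinj : Set.InjOn (fun j ↦ φ (ζ ^ j * u)) (Finset.range r) := by
    intro i hi j hj hij
    have hij' := congrArg ψ hij
    simp only [(hball (hmem _)).1] at hij'
    exact hζ.injOn_pow_mul hu0 hi hj hij'
  have hsub : (Finset.range r).image (fun j ↦ φ (ζ ^ j * u)) ⊆
      (Polynomial.nthRoots s (φ (u ^ r))).toFinset := by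
    intro w hw
    obtain ⟨j, -, rfl⟩ := Finset.mem_image.1 hw
    rw [Multiset.mem_toFinset, Polynomial.mem_nthRoots hs, ← (hball (hmem j)).2, mul_pow,
      ← pow_mul, mul_comm j, pow_mul, hζ.pow_eq_one, one_pow, one_mul]
  calc r = ((Finset.range r).image (fun j ↦ φ (ζ ^ j * u))).card := by
        rw [Finset.card_image_of_injOn hinj, Finset.card_range]
    _ ≤ _ := Finset.card_le_card hsub
    _ ≤ _ := Multiset.toFinset_card_le _
    _ ≤ s := Polynomial.card_nthRoots _ _

lemma eq_of_pow {r s : ℕ} (hr : 0 < r) (hs : 0 < s)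
    (H : IsGermConj (fun z ↦ z ^ r) (fun z ↦ z ^ s) φ ψ) : r = s :=
  (H.le_of_pow hr hs).antisymm <| (H.symm <| by
    simpa [hr.ne'] using (continuous_pow r).tendsto (0 : ℂ)).le_of_pow hs hr

/-- A germ of holomorphic conjugacy has a representative on suitable neighbourhoods of `0`. -/
lemma holLocallyConj {U₁ U₂ : Set ℂ} (H : IsGermConj f g φ ψ) (hφ : AnalyticAt ℂ φ 0)
    (hψ : AnalyticAt ℂ ψ 0) (hU₁ : U₁ ∈ 𝓝 0) (hU₂ : U₂ ∈ 𝓝 0) : HolLocallyConj f U₁ g U₂ := by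
  obtain ⟨A, hA, hAo, hA0⟩ := eventually_nhds_iff.1
    ((H.left_inv.and H.semiconj).and (hφ.eventually_analyticAt.and hU₁))
  obtain ⟨B, hB, hBo, hB0⟩ := eventually_nhds_iff.1
    (H.right_inv.and (hψ.eventually_analyticAt.and hU₂))
  have hφA : DifferentiableOn ℂ φ A := fun z hz ↦
    (hA z hz).2.1.differentiableAt.differentiableWithinAt
  have hψB : DifferentiableOn ℂ ψ B := fun z hz ↦
    (hB z hz).2.1.differentiableAt.differentiableWithinAt
  have hφ0 : φ 0 = 0 := eq_of_tendsto_nhds H.tendsto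
  have hψ0 : ψ 0 = 0 := eq_of_tendsto_nhds H.tendsto_inv
  refine ⟨φ, A ∩ φ ⁻¹' B, B ∩ ψ ⁻¹' A, hφA.continuousOn.isOpen_inter_preimage hAo hBo,
    hψB.continuousOn.isOpen_inter_preimage hBo hAo, ⟨hA0, by simpa [hφ0]⟩, ⟨hB0, by simpa [hψ0]⟩,
    fun z hz ↦ (hA z hz.1).2.2, fun z hz ↦ (hB z hz.1).2.2, hφA.mono inter_subset_left, ?_,
    ⟨ψ, hψB.mono inter_subset_left, fun z hz ↦ (hA z hz.1).1.1⟩, hφ0,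
    fun z hz _ ↦ (hA z hz.1).1.2⟩
  refine Set.InvOn.bijOn (f' := ψ) ⟨fun z hz ↦ (hA z hz.1).1.1, fun z hz ↦ (hB z hz.1).1⟩ ?_ ?_
  · intro z hz
    refine ⟨hz.2, ?_⟩
    rw [mem_preimage, (hA z hz.1).1.1]
    exact hz.1
  · intro z hz
    refine ⟨hz.2, ?_⟩
    rw [mem_preimage, (hB z hz.1).1]
    exact hz.1

end IsGermConj

lemma TopLocallyConj.exists_isGermConj {f g : ℂ → ℂ} {U₁ U₂ : Set ℂ}
    (H : TopLocallyConj f U₁ g U₂) (hf : Tendsto f (𝓝 0) (𝓝 0)) :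
    ∃ φ ψ, IsGermConj f g φ ψ := by
  obtain ⟨φ, W₁, W₂, hW₁, hW₂, h0₁, h0₂, -, -, hφ, hbij, ⟨ψ, hψ, hinv⟩, hφ0, hconj⟩ := H
  have hmem₁ := hW₁.mem_nhds h0₁
  have hmem₂ := hW₂.mem_nhds h0₂
  have hleft : ∀ z ∈ W₁, ψ (φ z) = z := hinv
  have hψ0 : ψ 0 = 0 := by simpa [hφ0] using hleft 0 h0₁
  have hφt := (hφ.continuousAt hmem₁).tendsto
  have hψt := (hψ.continuousAt hmem₂).tendsto
  rw [hφ0] at hφt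
  rw [hψ0] at hψt
  refine ⟨φ, ψ, hφt, hψt, ?_, ?_, ?_⟩
  · filter_upwards [hmem₁] with z hz using hleft z hz
  · filter_upwards [hmem₂] with w hw
    obtain ⟨z, hz, rfl⟩ := hbij.surjOn hw
    rw [hleft z hz]
  · filter_upwards [hmem₁, hf hmem₁] with z hz hfz using hconj z hz hfz

lemma HolLocallyConj.topLocallyConj {f g : ℂ → ℂ} {U₁ U₂ : Set ℂ}
    (H : HolLocallyConj f U₁ g U₂) : TopLocallyConj f U₁ g U₂ := by
  obtain ⟨φ, W₁, W₂, hW₁, hW₂, h0₁, h0₂, hs₁, hs₂, hφ, hbij, ⟨ψ, hψ, hinv⟩, hφ0, hconj⟩ := H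
  exact ⟨φ, W₁, W₂, hW₁, hW₂, h0₁, h0₂, hs₁, hs₂, hφ.continuousOn, hbij,
    ⟨ψ, hψ.continuousOn, hinv⟩, hφ0, hconj⟩

/-- A holomorphic germ with a zero of order `r` at `0` has the form `z ^ r * exp (G z)`. -/
lemma AnalyticAt.exists_eq_pow_mul_exp {f : ℂ → ℂ} {r : ℕ} (hf : AnalyticAt ℂ f 0)
    (hvanish : ∀ k, k < r → iteratedDeriv k f 0 = 0) (hlead : iteratedDeriv r f 0 ≠ 0) :
    ∃ G : ℂ → ℂ, AnalyticAt ℂ G 0 ∧ ∀ᶠ z in 𝓝 0, f z = z ^ r * Complex.exp (G z) := by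
  have hord : analyticOrderAt f 0 = r := by
    refine le_antisymm ?_ ((natCast_le_analyticOrderAt_iff_iteratedDeriv_eq_zero hf).2 hvanish)
    by_contra! hlt
    have hle : ((r + 1 : ℕ) : ℕ∞) ≤ analyticOrderAt f 0 := by
      push_cast
      exact Order.add_one_le_of_lt hlt
    exact hlead ((natCast_le_analyticOrderAt_iff_iteratedDeriv_eq_zero hf).1 hle r r.lt_succ_self)
  obtain ⟨g, hg, hg0, hfg⟩ := hf.analyticOrderAt_eq_natCast.1 hord
  refine ⟨fun z ↦ Complex.log (g z / g 0) + Complex.log (g 0), ?_, ?_⟩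
  · refine (AnalyticAt.clog (by fun_prop) ?_).add analyticAt_const
    simp [hg0, Complex.one_mem_slitPlane]
  · filter_upwards [hfg, hg.continuousAt.eventually_ne hg0] with z hz hgz
    rw [hz, Complex.exp_add, Complex.exp_log (div_ne_zero hgz hg0), Complex.exp_log hg0,
      div_mul_cancel₀ _ hg0, sub_zero, smul_eq_mul]

/-- A solution of the linearised Böttcher equation `S ∘ f = r • S - G`. -/
lemma exists_analyticAt_cohomological {f G : ℂ → ℂ} {r : ℕ} (hr : 2 ≤ r) {ρ M : ℝ} (hρ : 0 < ρ)
    (hf : DifferentiableOn ℂ f (Metric.ball 0 ρ))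
    (hmaps : MapsTo f (Metric.ball 0 ρ) (Metric.ball 0 ρ))
    (hG : DifferentiableOn ℂ G (Metric.ball 0 ρ)) (hM : ∀ z ∈ Metric.ball 0 ρ, ‖G z‖ ≤ M) :
    ∃ S : ℂ → ℂ, AnalyticAt ℂ S 0 ∧ ∀ z ∈ Metric.ball 0 ρ, S (f z) = r * S z - G z := by
  have hr0 : (r : ℂ) ≠ 0 := by exact_mod_cast (by lia : r ≠ 0)
  have hit (n : ℕ) : MapsTo f^[n] (Metric.ball 0 ρ) (Metric.ball 0 ρ) := hmaps.iterate n
  have hdiff (n : ℕ) : DifferentiableOn ℂ f^[n] (Metric.ball 0 ρ) := hf.iterate hmaps n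
  have hsum : Summable fun n : ℕ ↦ ((r : ℝ)⁻¹ ^ (n + 1)) * M := by
    refine Summable.mul_right _ ((summable_nat_add_iff 1).2
      (summable_geometric_of_lt_one (by positivity) (inv_lt_one_of_one_lt₀ ?_)))
    exact_mod_cast hr
  have hle (n : ℕ) (z : ℂ) (hz : z ∈ Metric.ball 0 ρ) :
      ‖(r : ℂ)⁻¹ ^ (n + 1) * G (f^[n] z)‖ ≤ (r : ℝ)⁻¹ ^ (n + 1) * M := by
    rw [norm_mul, norm_pow, norm_inv, Complex.norm_natCast]
    gcongr
    exact hM _ (hit n hz)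
  refine ⟨fun z ↦ ∑' n : ℕ, (r : ℂ)⁻¹ ^ (n + 1) * G (f^[n] z), ?_, fun z hz ↦ ?_⟩
  · refine (Complex.differentiableOn_tsum_of_summable_norm hsum (fun n ↦ ?_) Metric.isOpen_ball
      hle).analyticAt (Metric.ball_mem_nhds 0 hρ)
    exact (hG.comp (hdiff n) (hit n)).const_mul _
  · dsimp only
    have hsz : Summable fun n : ℕ ↦ (r : ℂ)⁻¹ ^ (n + 1) * G (f^[n] z) :=
      .of_norm_bounded hsum fun n ↦ hle n z hz
    rw [hsz.tsum_eq_zero_add, mul_add, ← tsum_mul_left]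
    simp only [zero_add, pow_one, Function.iterate_zero, id, mul_inv_cancel_left₀ hr0,
      add_sub_cancel_left, Function.iterate_succ_apply]
    congr! 2 with n
    rw [pow_succ' _ (n + 1), ← mul_assoc, ← mul_assoc, mul_inv_cancel₀ hr0, one_mul]

/-- **Böttcher's theorem**: a superattracting germ of order `r` is holomorphically conjugated to
`z ↦ z ^ r`. -/
lemma AnalyticAt.exists_isGermConj_pow {f : ℂ → ℂ} {r : ℕ} (hf : AnalyticAt ℂ f 0) (hr : 2 ≤ r)
    (hvanish : ∀ k, k < r → iteratedDeriv k f 0 = 0) (hlead : iteratedDeriv r f 0 ≠ 0) :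
    ∃ φ ψ, AnalyticAt ℂ φ 0 ∧ AnalyticAt ℂ ψ 0 ∧ IsGermConj f (fun z ↦ z ^ r) φ ψ := by
  obtain ⟨G, hG, hfG⟩ := hf.exists_eq_pow_mul_exp hvanish hlead
  have hsmall : ∀ᶠ z in 𝓝 (0 : ℂ), ‖z ^ (r - 1) * Complex.exp (G z)‖ < 1 := by
    have hc : ContinuousAt (fun z ↦ ‖z ^ (r - 1) * Complex.exp (G z)‖) 0 :=
      (((continuous_pow _).continuousAt).mul hG.continuousAt.cexp).norm
    refine hc.eventually_lt_const ?_
    simp [zero_pow (by lia : r - 1 ≠ 0)]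
  have hbdd : ∀ᶠ z in 𝓝 (0 : ℂ), ‖G z‖ < ‖G 0‖ + 1 :=
    hG.continuousAt.norm.eventually_lt_const (lt_add_one _)
  obtain ⟨ρ, hρ, hball⟩ := Metric.eventually_nhds_iff_ball.1
    ((hfG.and hsmall).and (hbdd.and (hf.eventually_analyticAt.and hG.eventually_analyticAt)))
  have hmaps : MapsTo f (Metric.ball 0 ρ) (Metric.ball 0 ρ) := by
    intro z hz
    obtain ⟨⟨hfz, hlt⟩, -⟩ := hball z hz
    have hpow : z ^ r = z * z ^ (r - 1) := (mul_pow_sub_one (by lia) z).symm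
    rw [mem_ball_zero_iff] at hz ⊢
    rw [hfz, hpow, mul_assoc, norm_mul]
    exact (mul_le_of_le_one_right (norm_nonneg _) hlt.le).trans_lt hz
  obtain ⟨S, hS, hSf⟩ := exists_analyticAt_cohomological hr hρ
    (fun z hz ↦ (hball z hz).2.2.1.differentiableAt.differentiableWithinAt) hmaps
    (fun z hz ↦ (hball z hz).2.2.2.differentiableAt.differentiableWithinAt)
    (fun z hz ↦ (hball z hz).2.1.le)
  set φ : ℂ → ℂ := fun z ↦ z * Complex.exp (S z) with hφdef
  have hφ : AnalyticAt ℂ φ 0 := analyticAt_id.mul hS.cexp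
  have hφ0 : φ 0 = 0 := by simp [hφdef]
  have hφ' : deriv φ 0 ≠ 0 := by
    have hd : HasDerivAt φ _ 0 := (hasDerivAt_id (0 : ℂ)).mul hS.differentiableAt.hasDerivAt.cexp
    have : deriv φ 0 = Complex.exp (S 0) := by simpa using hd.deriv
    rw [this]
    exact Complex.exp_ne_zero _
  have hψ := hφ.analyticAt_localInverse hφ'
  have hψt := HasStrictFDerivAt.localInverse_tendsto
    (hφ.hasStrictDerivAt.hasStrictFDerivAt_equiv hφ')
  have hright := hφ.hasStrictDerivAt.eventually_right_inverse hφ'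
  rw [hφ0] at hψ hψt hright
  refine ⟨φ, _, hφ, hψ, ?_, hψt, hφ.hasStrictDerivAt.eventually_left_inverse hφ', hright, ?_⟩
  · simpa [hφ0] using hφ.continuousAt.tendsto
  · filter_upwards [Metric.ball_mem_nhds 0 hρ] with z hz
    simp only [hφdef, hSf z hz]
    rw [(hball z hz).1.1, mul_pow, ← Complex.exp_nat_mul, mul_assoc, ← Complex.exp_add, add_sub_cancel]

/-- **Böttcher's theorem, part (ii).** Two one-dimensional holomorphic local dynamical systems
with superattracting fixed points at the origin, of orders `r` and `s`, are holomorphically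
locally conjugated iff they are topologically locally conjugated iff they have the same order;
in particular `z ↦ z^r` and `z ↦ z^s` are topologically locally conjugated iff `r = s`. -/
theorem superattracting_conj_iff_same_order
    (f₁ f₂ : ℂ → ℂ) (U₁ U₂ : Set ℂ) (r s : ℕ)
    (hU₁ : IsOpen U₁) (h0₁ : (0 : ℂ) ∈ U₁) (hf₁ : DifferentiableOn ℂ f₁ U₁)
    (hf₁0 : f₁ 0 = 0) (hf₁ne : ∃ z ∈ U₁, f₁ z ≠ z)
    (hU₂ : IsOpen U₂) (h0₂ : (0 : ℂ) ∈ U₂) (hf₂ : DifferentiableOn ℂ f₂ U₂)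
    (hf₂0 : f₂ 0 = 0) (hf₂ne : ∃ z ∈ U₂, f₂ z ≠ z)
    (hr : 2 ≤ r) (hvanish₁ : ∀ k, k < r → iteratedDeriv k f₁ 0 = 0)
    (hlead₁ : iteratedDeriv r f₁ 0 ≠ 0)
    (hs : 2 ≤ s) (hvanish₂ : ∀ k, k < s → iteratedDeriv k f₂ 0 = 0)
    (hlead₂ : iteratedDeriv s f₂ 0 ≠ 0) :
    (HolLocallyConj f₁ U₁ f₂ U₂ ↔ TopLocallyConj f₁ U₁ f₂ U₂) ∧
      (HolLocallyConj f₁ U₁ f₂ U₂ ↔ r = s) ∧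
      ∀ r' s' : ℕ, 2 ≤ r' → 2 ≤ s' →
        (TopLocallyConj (fun z => z ^ r') Set.univ (fun z => z ^ s') Set.univ ↔ r' = s') := by
  have hd₁ : AnalyticAt ℂ f₁ 0 := hf₁.analyticAt (hU₁.mem_nhds h0₁)
  have hd₂ : AnalyticAt ℂ f₂ 0 := hf₂.analyticAt (hU₂.mem_nhds h0₂)
  have ht₁ : Tendsto f₁ (𝓝 0) (𝓝 0) := by simpa [hf₁0] using hd₁.continuousAt.tendsto
  have ht₂ : Tendsto f₂ (𝓝 0) (𝓝 0) := by simpa [hf₂0] using hd₂.continuousAt.tendsto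
  obtain ⟨φ₁, ψ₁, hφ₁, hψ₁, H₁⟩ := hd₁.exists_isGermConj_pow hr hvanish₁ hlead₁
  obtain ⟨φ₂, ψ₂, hφ₂, hψ₂, H₂⟩ := hd₂.exists_isGermConj_pow hs hvanish₂ hlead₂
  have htop : TopLocallyConj f₁ U₁ f₂ U₂ → r = s := by
    intro H
    obtain ⟨φ, ψ, h⟩ := H.exists_isGermConj ht₁
    exact (((H₁.symm ht₁).trans h).trans H₂).eq_of_pow (by lia) (by lia)
  have hhol : r = s → HolLocallyConj f₁ U₁ f₂ U₂ := by
    rintro rfl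
    have hφ₁0 : φ₁ 0 = 0 := eq_of_tendsto_nhds H₁.tendsto
    have hψ₂0 : ψ₂ 0 = 0 := eq_of_tendsto_nhds H₂.tendsto_inv
    have hφ₂0 : φ₂ 0 = 0 := eq_of_tendsto_nhds H₂.tendsto
    exact (H₁.trans (H₂.symm ht₂)).holLocallyConj (hψ₂.comp_of_eq hφ₁ hφ₁0)
      (hψ₁.comp_of_eq hφ₂ hφ₂0) (hU₁.mem_nhds h0₁) (hU₂.mem_nhds h0₂)
  refine ⟨⟨HolLocallyConj.topLocallyConj, fun H ↦ hhol (htop H)⟩,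
    ⟨fun H ↦ htop H.topLocallyConj, hhol⟩, fun r' s' hr' hs' ↦ ⟨fun H ↦ ?_, ?_⟩⟩
  · obtain ⟨φ, ψ, h⟩ := H.exists_isGermConj <| by
      simpa [(by lia : r' ≠ 0)] using (continuous_pow r').tendsto (0 : ℂ)
    exact h.eq_of_pow (by lia) (by lia)
  · rintro rfl
    have hid : IsGermConj (fun z ↦ z ^ r') (fun z ↦ z ^ r') id id := by
      constructor <;> simp [tendsto_id]
    exact (hid.holLocallyConj analyticAt_id analyticAt_id univ_mem univ_mem).topLocallyConj
end

section
/- Let f be a holomorphic local dynamical system at 0 ∈ ℂ whose multiplier λ = f'(0) is a primitive root of unity of order q. Then f is holomorphically locally conjugated to the rotation g(z) = λz if and only if the q-th iterate f^q is the identity on some neighbourhood of 0. -/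
open Set Filter Topology

theorem AnalyticAt.iterate_of_fixed {f : ℂ → ℂ} {x : ℂ} (hf : AnalyticAt ℂ f x) (hx : f x = x)
    (k : ℕ) : AnalyticAt ℂ f^[k] x := by
  induction k with
  | zero => exact analyticAt_id
  | succ k ih =>
    rw [Function.iterate_succ']
    refine AnalyticAt.comp ?_ ih
    rwa [Function.iterate_fixed hx]

/-- An analytic map with nonzero derivative restricts to a biholomorphism between open sets, the
source lying inside a prescribed neighbourhood. -/
theorem AnalyticAt.exists_biholomorphism {φ : ℂ → ℂ} {x : ℂ} (hφ : AnalyticAt ℂ φ x)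
    (hd : deriv φ x ≠ 0) {N : Set ℂ} (hN : N ∈ 𝓝 x) :
    ∃ W₁ W₂ : Set ℂ, IsOpen W₁ ∧ IsOpen W₂ ∧ x ∈ W₁ ∧ W₁ ⊆ N ∧ DifferentiableOn ℂ φ W₁ ∧
      BijOn φ W₁ W₂ ∧ ∃ ψ : ℂ → ℂ, DifferentiableOn ℂ ψ W₂ ∧ EqOn (ψ ∘ φ) id W₁ := by
  have hs : HasStrictDerivAt φ (deriv φ x) x := hφ.hasStrictDerivAt
  have hs' := hs.hasStrictFDerivAt_equiv hd
  set e := hs'.toOpenPartialHomeomorph φ with he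
  have hcoe : (e : ℂ → ℂ) = φ := hs'.toOpenPartialHomeomorph_coe
  have hx : x ∈ e.source := hs'.mem_toOpenPartialHomeomorph_source
  have hev : ∀ᶠ z in 𝓝 x, z ∈ e.source ∧ z ∈ N ∧ DifferentiableAt ℂ φ z ∧ deriv φ z ≠ 0 := by
    filter_upwards [e.open_source.mem_nhds hx, hN, hφ.eventually_analyticAt,
      hφ.deriv.continuousAt.eventually_ne hd] with z h1 h2 h3 h4
    exact ⟨h1, h2, h3.differentiableAt, h4⟩
  obtain ⟨W, hW, hWo, hxW⟩ := eventually_nhds_iff.1 hev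
  refine ⟨W, φ '' W, hWo, ?_, hxW, fun z hz => (hW z hz).2.1,
    fun z hz => (hW z hz).2.2.1.differentiableWithinAt, ?_, e.symm, ?_, ?_⟩
  · rw [← hcoe]
    exact e.isOpen_image_of_subset_source hWo fun z hz => (hW z hz).1
  · rw [← hcoe]
    exact (e.injOn.mono fun z hz => (hW z hz).1).bijOn_image
  · rintro _ ⟨z, hz, rfl⟩
    obtain ⟨hz1, -, hz3, hz4⟩ := hW z hz
    have hsymm : e.symm (φ z) = z := by rw [← hcoe]; exact e.left_inv hz1
    refine (HasDerivAt.differentiableAt (f' := (deriv φ z)⁻¹)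
      (e.hasDerivAt_symm ?_ hz4 ?_)).differentiableWithinAt
    · rw [← hcoe]; exact e.map_source hz1
    · rw [hsymm, hcoe]; exact hz3.hasDerivAt
  · intro z hz
    simpa [hcoe] using e.left_inv (hW z hz).1

/-- The average of the rescaled iterates `lam⁻ᵏ f^[k]`, which linearizes a finite-order germ `f`. -/
noncomputable def iterateAverage (f : ℂ → ℂ) (lam : ℂ) (q : ℕ) (z : ℂ) : ℂ :=
  (q : ℂ)⁻¹ * ∑ k ∈ Finset.range q, lam⁻¹ ^ k * f^[k] z

theorem iterateAverage_apply_map {f : ℂ → ℂ} {lam : ℂ} {q : ℕ} (hlam : lam ≠ 0)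
    (hq : lam ^ q = 1) {z : ℂ} (hz : f^[q] z = z) :
    iterateAverage f lam q (f z) = lam * iterateAverage f lam q z := by
  have hterm : ∀ k, lam⁻¹ ^ k * f^[k] (f z) = lam * (lam⁻¹ ^ (k + 1) * f^[k + 1] z) := by
    intro k
    rw [Function.iterate_succ_apply, pow_succ]
    field_simp
  have hshift : ∑ k ∈ Finset.range q, lam⁻¹ ^ (k + 1) * f^[k + 1] z =
      ∑ k ∈ Finset.range q, lam⁻¹ ^ k * f^[k] z := by
    have h := Finset.sum_range_succ (fun k => lam⁻¹ ^ k * f^[k] z) q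
    rw [Finset.sum_range_succ'] at h
    simpa [hz, inv_pow, hq] using h
  simp only [iterateAverage, hterm, ← Finset.mul_sum]
  rw [hshift]
  ring

theorem hasDerivAt_iterateAverage {f : ℂ → ℂ} {lam : ℂ} {q : ℕ} (hlam : lam ≠ 0) (hq : q ≠ 0)
    {x : ℂ} (hf : HasDerivAt f lam x) (hx : f x = x) :
    HasDerivAt (iterateAverage f lam q) 1 x := by
  have h : HasDerivAt (iterateAverage f lam q)
      ((q : ℂ)⁻¹ * ∑ k ∈ Finset.range q, lam⁻¹ ^ k * lam ^ k) x :=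
    (HasDerivAt.fun_sum fun k _ => (hf.iterate x hx k).const_mul (lam⁻¹ ^ k)).const_mul _
  convert h using 1
  have hq' : (q : ℂ) ≠ 0 := Nat.cast_ne_zero.2 hq
  simp [hlam, hq']

theorem AnalyticAt.iterateAverage {f : ℂ → ℂ} {x : ℂ} (hf : AnalyticAt ℂ f x) (hx : f x = x)
    (lam : ℂ) (q : ℕ) : AnalyticAt ℂ (iterateAverage f lam q) x :=
  analyticAt_const.mul <| Finset.analyticAt_fun_sum _ fun k _ =>
    analyticAt_const.mul (hf.iterate_of_fixed hx k)

/-- A holomorphic local dynamical system whose multiplier `λ` is a primitive `q`-th root of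
unity is holomorphically locally conjugated to the rotation `z ↦ λ z` if and only if its `q`-th
iterate is the identity on some neighbourhood of the origin (on which all the intermediate
iterates are defined, i.e. stay in the domain `U`). -/
theorem conj_to_rotation_iff_iterate_eq_id
    (f : ℂ → ℂ) (U : Set ℂ) (hU : IsOpen U) (h0 : (0 : ℂ) ∈ U)
    (hf : DifferentiableOn ℂ f U) (hf0 : f 0 = 0) (hfne : ∃ z ∈ U, f z ≠ z)
    (lam : ℂ) (q : ℕ) (hq : 1 ≤ q) (hlam : IsPrimitiveRoot lam q)
    (hmult : deriv f 0 = lam) :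
    HolLocallyConj f U (fun z => lam * z) Set.univ ↔
      ∃ V : Set ℂ, IsOpen V ∧ (0 : ℂ) ∈ V ∧ (∀ z ∈ V, ∀ k, k < q → f^[k] z ∈ U) ∧
        ∀ z ∈ V, f^[q] z = z := by
  have hfan : AnalyticAt ℂ f 0 := hf.analyticAt (hU.mem_nhds h0)
  have hiter : ∀ (k : ℕ) {W : Set ℂ}, IsOpen W → (0 : ℂ) ∈ W → ∀ᶠ z in 𝓝 0, f^[k] z ∈ W := by
    intro k W hW h0W
    refine (hfan.iterate_of_fixed hf0 k).continuousAt.eventually_mem (hW.mem_nhds ?_)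
    rwa [Function.iterate_fixed hf0]
  have hq0 : q ≠ 0 := by omega
  constructor
  · rintro ⟨φ, W₁, W₂, hW₁, -, h0W₁, -, hW₁U, -, -, hbij, -, -, hconj⟩
    have hev : ∀ᶠ z in 𝓝 (0 : ℂ), ∀ k ∈ Finset.range (q + 1), f^[k] z ∈ W₁ :=
      (Filter.eventually_all_finset _).2 fun k _ => hiter k hW₁ h0W₁
    obtain ⟨V, hV, hVo, h0V⟩ := eventually_nhds_iff.1 hev
    have hmem : ∀ z ∈ V, ∀ k ≤ q, f^[k] z ∈ W₁ := fun z hz k hk =>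
      hV z hz k (Finset.mem_range.2 (by omega))
    refine ⟨V, hVo, h0V, fun z hz k hk => hW₁U (hmem z hz k hk.le), fun z hz => ?_⟩
    have hpow : ∀ k ≤ q, φ (f^[k] z) = lam ^ k * φ z := by
      intro k
      induction k with
      | zero => simp
      | succ k ih =>
        intro hk
        have hk1 := hmem z hz (k + 1) hk
        rw [Function.iterate_succ_apply'] at hk1 ⊢
        rw [hconj _ (hmem z hz k (by omega)) hk1, ih (by omega)]
        ring
    refine hbij.injOn (hmem z hz q le_rfl) (hmem z hz 0 (Nat.zero_le q)) ?_
    rw [hpow q le_rfl, hlam.pow_eq_one, one_mul]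
  · rintro ⟨V, hVo, h0V, -, hVq⟩
    have hlam0 : lam ≠ 0 := hlam.ne_zero hq0
    have hder : HasDerivAt f lam 0 := hmult ▸ hfan.differentiableAt.hasDerivAt
    have hφ0 : iterateAverage f lam q 0 = 0 := by
      simp [iterateAverage, Function.iterate_fixed hf0]
    obtain ⟨W₁, W₂, hW₁, hW₂, h0W₁, hsub, hdiff, hbij, hinv⟩ :=
      (hfan.iterateAverage hf0 lam q).exists_biholomorphism
        (by rw [(hasDerivAt_iterateAverage hlam0 hq0 hder hf0).deriv]; exact one_ne_zero)
        ((hU.inter hVo).mem_nhds ⟨h0, h0V⟩)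
    exact ⟨iterateAverage f lam q, W₁, W₂, hW₁, hW₂, h0W₁, hφ0 ▸ hbij.mapsTo h0W₁,
      fun z hz => (hsub hz).1, subset_univ _, hdiff, hbij, hinv, hφ0,
      fun z hz _ => iterateAverage_apply_map hlam0 hlam.pow_eq_one (hVq z (hsub hz).2)⟩
end

section
/- Let f be a holomorphic local dynamical system at 0 ∈ ℂ tangent to the identity with multiplicity r+1 ≥ 2, i.e. f(z) = z + a_{r+1}z^{r+1} + ⋯ with a_{r+1} ≠ 0. Then: (i) for each of the r attracting directions there exists an attracting petal, for each of the r repelling directions there exists a repelling petal, and the union of these 2r petals together with the origin forms a neighbourhood of the origin; (ii) K_f \ {0} is the disjoint union of the basins centered at the r attracting directions, where K_f is the stable set of f restricted to that neighbourhood. -/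
open Set Filter Topology

/-- The stable set of `f` relative to the domain `U`: the set of points whose whole forward
orbit stays inside `U`. -/
def stableSet (f : ℂ → ℂ) (U : Set ℂ) : Set ℂ :=
  {z | ∀ k : ℕ, f^[k] z ∈ U}

/-- The basin centered at the direction `v`, relative to the domain `U`: the points of the
stable set, different from `0`, whose orbit tends to `0` tangentially to `v`. -/
def basin (f : ℂ → ℂ) (U : Set ℂ) (v : ℂ) : Set ℂ :=
  {z | z ∈ stableSet f U ∧ z ≠ 0 ∧ Tendsto (fun k => f^[k] z) atTop (𝓝 0) ∧
    Tendsto (fun k => f^[k] z / (‖f^[k] z‖ : ℂ)) atTop (𝓝 v)}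

/-- `v` is an attracting direction for a map tangent to the identity with leading coefficient
`a = a_{r+1}`: `v` is a unit vector and `a v^r` is real and negative. -/
def IsAttractingDir (a : ℂ) (r : ℕ) (v : ℂ) : Prop :=
  ‖v‖ = 1 ∧ (a * v ^ r).im = 0 ∧ (a * v ^ r).re < 0

/-- `v` is a repelling direction: `v` is a unit vector and `a v^r` is real and positive. -/
def IsRepellingDir (a : ℂ) (r : ℕ) (v : ℂ) : Prop :=
  ‖v‖ = 1 ∧ (a * v ^ r).im = 0 ∧ 0 < (a * v ^ r).re

/-- `P` is an attracting petal centered at the direction `v` for `f` (with domain `U`): an open,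
simply connected, `f`-invariant subset of `K_f \ {0}` such that a point of `K_f \ {0}` belongs
to the basin centered at `v` iff its orbit intersects `P`. -/
def IsAttractingPetal (f : ℂ → ℂ) (U : Set ℂ) (v : ℂ) (P : Set ℂ) : Prop :=
  IsOpen P ∧ SimplyConnectedSpace P ∧ Set.MapsTo f P P ∧
    P ⊆ stableSet f U \ {0} ∧
    ∀ z ∈ stableSet f U \ {0}, (z ∈ basin f U v ↔ ∃ k : ℕ, f^[k] z ∈ P)

namespace LeauFatou

/-- The Fatou coordinate `-1 / (r a z^r)`, in which `z + a z^(r+1) + ⋯` becomes almost the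
translation by `1`. -/
noncomputable def fatouCoord (a : ℂ) (r : ℕ) (z : ℂ) : ℂ := -((r : ℂ) * a * z ^ r)⁻¹

/-- The region of the Fatou coordinate plane to the right of two rays at angles `± 3π/4`. -/
def petalRegion (R : ℝ) : Set ℂ := {ζ | R < ζ.re + |ζ.im|}

/-- The positive real `c` with `c ^ r = 1 / (r |a|)`. -/
noncomputable def petalScale (a : ℂ) (r : ℕ) : ℝ := ((r * ‖a‖)⁻¹ : ℝ) ^ ((r : ℝ)⁻¹)

/-- The inverse branch of the Fatou coordinate around the direction `v`. -/
noncomputable def petalMap (a : ℂ) (r : ℕ) (v ζ : ℂ) : ℂ :=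
  v * petalScale a r / ζ ^ ((r : ℂ)⁻¹)

/-- The petal around the direction `v`. -/
def petal (a : ℂ) (r : ℕ) (R : ℝ) (v : ℂ) : Set ℂ := petalMap a r v '' petalRegion R

section Coordinates

variable {a v z ζ : ℂ} {r : ℕ} {R : ℝ}

lemma petalScale_pos (hr : r ≠ 0) (ha : a ≠ 0) : 0 < petalScale a r := by
  unfold petalScale
  have := norm_pos_iff.2 ha
  positivity

lemma petalScale_pow (hr : r ≠ 0) : petalScale a r ^ r = (r * ‖a‖)⁻¹ := by
  unfold petalScale
  exact Real.rpow_inv_natCast_pow (by positivity) hr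

lemma isAttractingDir_iff : IsAttractingDir a r v ↔ ‖v‖ = 1 ∧ a * v ^ r = -‖a‖ ∧ a ≠ 0 := by
  constructor
  · rintro ⟨h1, h2, h3⟩
    have hn : ‖a * v ^ r‖ = ‖a‖ := by simp [h1]
    refine ⟨h1, ?_, ?_⟩
    · rw [← hn, ← Complex.abs_re_eq_norm.2 h2, abs_of_neg h3]
      apply Complex.ext <;> simp [h2]
    · rintro rfl
      simp at h3
  · rintro ⟨h1, h2, h3⟩
    refine ⟨h1, ?_, ?_⟩ <;> rw [h2] <;> simp [h3]

lemma isRepellingDir_iff : IsRepellingDir a r v ↔ IsAttractingDir (-a) r v := by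
  simp only [IsRepellingDir, IsAttractingDir, neg_mul, Complex.neg_im, Complex.neg_re,
    neg_eq_zero, Left.neg_neg_iff]

lemma ne_zero_of_mem_petalRegion (hR : 0 ≤ R) (h : ζ ∈ petalRegion R) : ζ ≠ 0 := by
  rintro rfl
  simp only [petalRegion, mem_ofPred_eq, Complex.zero_re, Complex.zero_im, abs_zero] at h
  linarith

lemma mem_slitPlane_of_mem_petalRegion (hR : 0 ≤ R) (h : ζ ∈ petalRegion R) :
    ζ ∈ Complex.slitPlane := by
  rw [Complex.mem_slitPlane_iff]
  by_contra! hc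
  simp only [petalRegion, mem_ofPred_eq, hc.2, abs_zero] at h
  linarith [hc.1]

lemma abs_arg_lt_of_mem_petalRegion (hR : 0 ≤ R) (h : ζ ∈ petalRegion R) :
    |ζ.arg| < 3 * Real.pi / 4 := by
  have h0 := norm_pos_iff.2 (ne_zero_of_mem_petalRegion hR h)
  simp only [petalRegion, mem_ofPred_eq] at h
  rw [← Complex.norm_mul_cos_arg, ← Complex.norm_mul_sin_arg, abs_mul, abs_norm, ← mul_add] at h
  have h1 : 0 < Real.cos |ζ.arg| + Real.sin |ζ.arg| := by
    have : Real.sin |ζ.arg| = |Real.sin ζ.arg| := by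
      rw [← abs_of_nonneg
        (Real.sin_nonneg_of_nonneg_of_le_pi (abs_nonneg _) (Complex.abs_arg_le_pi ζ))]
      rcases abs_choice ζ.arg with h | h <;> rw [h]
      rw [Real.sin_neg, abs_neg]
    rw [Real.cos_abs, this]
    exact pos_of_mul_pos_right (hR.trans_lt h) h0.le
  by_contra! hc
  have h2 : Real.sin (|ζ.arg| + Real.pi / 4 - Real.pi) =
      -((Real.cos |ζ.arg| + Real.sin |ζ.arg|) * (√2 / 2)) := by
    rw [Real.sin_sub_pi, Real.sin_add, Real.cos_pi_div_four, Real.sin_pi_div_four]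
    ring
  have h3 : 0 ≤ Real.sin (|ζ.arg| + Real.pi / 4 - Real.pi) := by
    apply Real.sin_nonneg_of_nonneg_of_le_pi
    · linarith
    · linarith [Complex.abs_arg_le_pi ζ, Real.pi_pos]
  have h4 : 0 < (Real.cos |ζ.arg| + Real.sin |ζ.arg|) * (√2 / 2) := by positivity
  linarith

lemma isOpen_petalRegion : IsOpen (petalRegion R) :=
  isOpen_lt continuous_const (by fun_prop)

lemma contractibleSpace_petalRegion : ContractibleSpace (petalRegion R) := by
  have h1 : ((R + 1 : ℝ) : ℂ) ∈ petalRegion R := by simp [petalRegion]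
  refine StarConvex.contractibleSpace (x := ((R + 1 : ℝ) : ℂ)) ?_ ⟨_, h1⟩
  intro y hy s t hs ht hst
  simp only [petalRegion, mem_ofPred_eq] at hy ⊢
  have him : (s • ((R + 1 : ℝ) : ℂ) + t • y).im = t * y.im := by simp
  have hre : (s • ((R + 1 : ℝ) : ℂ) + t • y).re = s * (R + 1) + t * y.re := by
    simp [-Complex.ofReal_add]
  rw [him, hre, abs_mul, abs_of_nonneg ht]
  have h2 : s * (R + 1) + t * y.re + t * |y.im| = R + s + t * (y.re + |y.im| - R) := by
    have : s = 1 - t := by linarith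
    subst this
    ring
  rw [h2]
  rcases hs.eq_or_lt with rfl | hs
  · have : t = 1 := by linarith
    subst this
    linarith
  · have : 0 ≤ t * (y.re + |y.im| - R) := mul_nonneg ht (by linarith)
    linarith

lemma le_norm_of_mem_petalRegion (h : ζ ∈ petalRegion R) : R ≤ 2 * ‖ζ‖ := by
  simp only [petalRegion, mem_ofPred_eq] at h
  linarith [Complex.abs_re_le_norm ζ, Complex.abs_im_le_norm ζ, le_abs_self ζ.re]

lemma petalMap_ne_zero (hr : r ≠ 0) (hv : IsAttractingDir a r v) (hζ : ζ ≠ 0) :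
    petalMap a r v ζ ≠ 0 := by
  have ha := (isAttractingDir_iff.1 hv).2.2
  have h1 : v ≠ 0 := by
    rintro rfl
    simpa using hv.1
  have h2 : (petalScale a r : ℂ) ≠ 0 := by exact_mod_cast (petalScale_pos hr ha).ne'
  exact div_ne_zero (mul_ne_zero h1 h2) (by simp [Complex.cpow_eq_zero_iff, hζ])

lemma fatouCoord_petalMap (hr : r ≠ 0) (hv : IsAttractingDir a r v) :
    fatouCoord a r (petalMap a r v ζ) = ζ := by
  obtain ⟨h1, h2, ha⟩ := isAttractingDir_iff.1 hv
  have hc : (petalScale a r : ℂ) ^ r = ((r : ℂ) * (‖a‖ : ℂ))⁻¹ := by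
    exact_mod_cast congrArg ((↑) : ℝ → ℂ) (petalScale_pow (a := a) hr)
  have ha' : (‖a‖ : ℂ) ≠ 0 := by simpa using ha
  have hr' : (r : ℂ) ≠ 0 := by simpa using hr
  unfold fatouCoord petalMap
  rw [div_pow, mul_pow, Complex.cpow_nat_inv_pow _ hr, hc]
  have : (r : ℂ) * a * (v ^ r * ((r : ℂ) * (‖a‖ : ℂ))⁻¹ / ζ) = -ζ⁻¹ := by
    rw [show (r : ℂ) * a * (v ^ r * ((r : ℂ) * (‖a‖ : ℂ))⁻¹ / ζ) =
      (r : ℂ) * (a * v ^ r) * ((r : ℂ) * (‖a‖ : ℂ))⁻¹ * ζ⁻¹ by ring, h2]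
    field_simp
  rw [this, inv_neg, inv_inv, neg_neg]

lemma fatouCoord_neg : fatouCoord (-a) r z = -fatouCoord a r z := by
  simp [fatouCoord, ← inv_neg]

lemma petalMap_continuousAt (h : ζ ∈ Complex.slitPlane) : ContinuousAt (petalMap a r v) ζ := by
  have h0 := Complex.slitPlane_ne_zero h
  refine continuousAt_const.div (ContinuousAt.cpow continuousAt_id continuousAt_const h) ?_
  simp [Complex.cpow_eq_zero_iff, h0]

lemma continuousAt_fatouCoord (ha : a ≠ 0) (hr : r ≠ 0) (hz : z ≠ 0) :
    ContinuousAt (fatouCoord a r) z := by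
  unfold fatouCoord
  refine ContinuousAt.neg (ContinuousAt.inv₀ (by fun_prop) ?_)
  simp [ha, hr, hz]

lemma isOpen_petal (hr : r ≠ 0) (hR : 0 ≤ R) (hv : IsAttractingDir a r v) :
    IsOpen (petal a r R v) := by
  have ha := (isAttractingDir_iff.1 hv).2.2
  rw [isOpen_iff_mem_nhds]
  rintro _ ⟨ζ, hζ, rfl⟩
  have hs := mem_slitPlane_of_mem_petalRegion hR hζ
  have h0 := Complex.slitPlane_ne_zero hs
  have hd := ((hasStrictDerivAt_const ζ (v * petalScale a r)).div
    (Complex.hasStrictDerivAt_cpow_const (c := (r : ℂ)⁻¹) hs)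
    (by simp [Complex.cpow_eq_zero_iff, h0]))
  have hv0 : v ≠ 0 := by
    rintro rfl
    simpa using hv.1
  have h2 : (petalScale a r : ℂ) ≠ 0 := by exact_mod_cast (petalScale_pos hr ha).ne'
  have := hd.map_nhds_eq (by simp [Complex.cpow_eq_zero_iff, h0, hv0, h2, hr])
  change map (petalMap a r v) _ = 𝓝 (petalMap a r v ζ) at this
  rw [← this]
  exact image_mem_map (isOpen_petalRegion.mem_nhds hζ)

lemma simplyConnectedSpace_petal (hr : r ≠ 0) (hR : 0 ≤ R) (hv : IsAttractingDir a r v) :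
    SimplyConnectedSpace (petal a r R v) := by
  have ha := (isAttractingDir_iff.1 hv).2.2
  have := contractibleSpace_petalRegion (R := R)
  let e : petal a r R v ≃ₜ petalRegion R :=
    { toFun := fun z => ⟨fatouCoord a r z, by
        obtain ⟨ζ, hζ, h⟩ := z.2
        rwa [← h, fatouCoord_petalMap hr hv]⟩
      invFun := fun ζ => ⟨petalMap a r v ζ, mem_image_of_mem _ ζ.2⟩
      left_inv := by
        rintro ⟨_, ζ, hζ, rfl⟩
        simp [fatouCoord_petalMap hr hv]
      right_inv := by
        rintro ⟨ζ, hζ⟩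
        simp [fatouCoord_petalMap hr hv]
      continuous_toFun := by
        refine Continuous.subtype_mk (continuous_iff_continuousAt.2 ?_) _
        rintro ⟨_, ζ, hζ, rfl⟩
        exact ContinuousAt.comp (g := fatouCoord a r) (continuousAt_fatouCoord ha hr
          (petalMap_ne_zero hr hv (ne_zero_of_mem_petalRegion hR hζ))) continuousAt_subtype_val
      continuous_invFun := by
        refine Continuous.subtype_mk (continuous_iff_continuousAt.2 ?_) _
        rintro ⟨ζ, hζ⟩
        exact ContinuousAt.comp (g := petalMap a r v)
          (petalMap_continuousAt (mem_slitPlane_of_mem_petalRegion hR hζ))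
          continuousAt_subtype_val }
  have := e.contractibleSpace
  infer_instance

lemma norm_petalMap_pow (hr : r ≠ 0) (hv : ‖v‖ = 1) :
    ‖petalMap a r v ζ‖ ^ r = (r * ‖a‖)⁻¹ / ‖ζ‖ := by
  rw [← norm_pow, petalMap, div_pow, mul_pow, Complex.cpow_nat_inv_pow _ hr, norm_div, norm_mul,
    norm_pow, hv, one_pow, one_mul, norm_pow, Complex.norm_real, ← petalScale_pow hr,
    Real.norm_eq_abs, pow_abs, abs_of_nonneg]
  rw [petalScale_pow hr]
  positivity

lemma tendsto_petalMap_cobounded (hr : r ≠ 0) (hv : ‖v‖ = 1) :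
    Tendsto (petalMap a r v) (Bornology.cobounded ℂ) (𝓝 0) := by
  rw [tendsto_zero_iff_norm_tendsto_zero]
  have h : Tendsto (fun ζ => (‖petalMap a r v ζ‖ ^ r) ^ ((r : ℝ)⁻¹))
      (Bornology.cobounded ℂ) (𝓝 (0 ^ ((r : ℝ)⁻¹))) := by
    refine Tendsto.rpow_const ?_ (Or.inr (by positivity))
    simp_rw [norm_petalMap_pow hr hv]
    exact tendsto_const_nhds.div_atTop tendsto_norm_cobounded_atTop
  rw [Real.zero_rpow (by simpa using hr)] at h
  refine h.congr fun ζ => ?_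
  exact Real.pow_rpow_inv_natCast (norm_nonneg _) hr

lemma eventually_petal_subset (hr : r ≠ 0) {W : Set ℂ} (hW : W ∈ 𝓝 0) :
    ∀ᶠ R in atTop, ∀ v, ‖v‖ = 1 → petal a r R v ⊆ W := by
  obtain ⟨δ, hδ, hW⟩ := Metric.mem_nhds_iff.1 hW
  have h := (tendsto_petalMap_cobounded (a := a) hr norm_one).eventually
    (Metric.ball_mem_nhds 0 hδ)
  obtain ⟨R₀, -, hR₀⟩ := (Metric.hasBasis_cobounded_compl_closedBall (0 : ℂ)).mem_iff.1 h
  filter_upwards [eventually_gt_atTop (2 * R₀)] with R hR v hv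
  rintro _ ⟨ζ, hζ, rfl⟩
  apply hW
  have h1 := hR₀ (a := ζ) (by
    have := le_norm_of_mem_petalRegion hζ
    simp only [mem_compl_iff, Metric.mem_closedBall, dist_zero_right]
    linarith)
  simpa [petalMap, hv] using h1

lemma exists_mem_petal (hr : r ≠ 0) (ha : a ≠ 0) (hz : z ≠ 0)
    (h : fatouCoord a r z ∈ petalRegion R) :
    ∃ v, IsAttractingDir a r v ∧ z ∈ petal a r R v := by
  set ζ := fatouCoord a r z with hζ
  have hc := (petalScale_pos hr ha)
  have hc0 : (petalScale a r : ℂ) ≠ 0 := by exact_mod_cast hc.ne'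
  have hr' : (r : ℂ) ≠ 0 := by simpa using hr
  have ha' : (‖a‖ : ℂ) ≠ 0 := by simpa using ha
  have hζ0 : ζ ≠ 0 := by simp [hζ, fatouCoord, hr, ha, hz]
  have hcr : (petalScale a r : ℂ) ^ r = ((r : ℂ) * (‖a‖ : ℂ))⁻¹ := by
    exact_mod_cast congrArg ((↑) : ℝ → ℂ) (petalScale_pow (a := a) hr)
  have hu : ζ ^ ((r : ℂ)⁻¹) ≠ 0 := by simp [Complex.cpow_eq_zero_iff, hζ0]
  have hpow : a * (z * ζ ^ ((r : ℂ)⁻¹) / petalScale a r) ^ r = -‖a‖ := by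
    rw [div_pow, mul_pow, Complex.cpow_nat_inv_pow _ hr, hcr, hζ, fatouCoord]
    field_simp
  refine ⟨z * ζ ^ ((r : ℂ)⁻¹) / petalScale a r, isAttractingDir_iff.2 ⟨?_, hpow, ha⟩, ζ, h, ?_⟩
  · have h1 := congrArg norm hpow
    rw [norm_mul, norm_pow, norm_neg, Complex.norm_real, norm_norm] at h1
    have h2 : ‖z * ζ ^ ((r : ℂ)⁻¹) / petalScale a r‖ ^ r = 1 :=
      mul_left_cancel₀ (norm_ne_zero_iff.2 ha) (by rw [h1, mul_one])
    exact (pow_eq_one_iff_of_nonneg (norm_nonneg _) hr).1 h2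
  · rw [petalMap, div_mul_cancel₀ _ hc0, mul_div_cancel_right₀ _ hu]

lemma mem_petal_of_arg (hr : r ≠ 0) (hv : IsAttractingDir a r v) (hz : z ≠ 0)
    (h : fatouCoord a r z ∈ petalRegion R)
    (hroot : ((v * petalScale a r / z) ^ r) ^ ((r : ℂ)⁻¹) = v * petalScale a r / z) :
    z ∈ petal a r R v := by
  obtain ⟨h1, h2, ha⟩ := isAttractingDir_iff.1 hv
  have hc : (petalScale a r : ℂ) ^ r = ((r : ℂ) * (‖a‖ : ℂ))⁻¹ := by
    exact_mod_cast congrArg ((↑) : ℝ → ℂ) (petalScale_pow (a := a) hr)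
  have ha' : (‖a‖ : ℂ) ≠ 0 := by simpa using ha
  have hr' : (r : ℂ) ≠ 0 := by simpa using hr
  have hv0 : v ≠ 0 := by
    rintro rfl
    simpa using hv.1
  have hc0 : (petalScale a r : ℂ) ≠ 0 := by exact_mod_cast (petalScale_pos hr ha).ne'
  have h3 : fatouCoord a r z = (v * petalScale a r / z) ^ r := by
    have : v ^ r = -‖a‖ / a := by rw [eq_div_iff ha, ← h2, mul_comm]
    rw [fatouCoord, div_pow, mul_pow, hc, this]
    field_simp
  refine ⟨_, h, ?_⟩
  rw [petalMap, h3, hroot]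
  field_simp

end Coordinates

section Dynamics

variable {f : ℂ → ℂ} {a v z ζ : ℂ} {r : ℕ} {R : ℝ}

lemma tendsto_div_self (hr : r ≠ 0)
    (h : Tendsto (fun z => (f z - z) / z ^ (r + 1)) (𝓝[≠] 0) (𝓝 a)) :
    Tendsto (fun z => f z / z) (𝓝[≠] 0) (𝓝 1) := by
  have h1 : Tendsto (fun z : ℂ => z ^ r) (𝓝[≠] 0) (𝓝 0) := by
    have : ContinuousAt (fun z : ℂ => z ^ r) 0 := by fun_prop
    simpa [ContinuousAt, hr] using this.tendsto.mono_left nhdsWithin_le_nhds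
  have h2 := (h1.mul h).const_add 1
  rw [zero_mul, add_zero] at h2
  refine h2.congr' ?_
  filter_upwards [self_mem_nhdsWithin] with z hz
  have hz : z ≠ 0 := hz
  field_simp
  ring

lemma tendsto_fatouCoord_sub (hr : r ≠ 0) (ha : a ≠ 0)
    (h : Tendsto (fun z => (f z - z) / z ^ (r + 1)) (𝓝[≠] 0) (𝓝 a)) :
    Tendsto (fun z => fatouCoord a r (f z) - fatouCoord a r z) (𝓝[≠] 0) (𝓝 1) := by
  have hr' : (r : ℂ) ≠ 0 := by simpa using hr
  set φ : ℂ → ℂ := fun w => (w ^ r)⁻¹ with hφ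
  have hd : HasDerivAt φ (-r) 1 := by
    have := (hasDerivAt_pow r (1 : ℂ)).inv (by simp)
    exact this.congr_deriv (by simp)
  have hc : ContinuousAt (dslope φ 1) 1 := continuousAt_dslope_same.2 hd.differentiableAt
  have h1 := hc.tendsto.comp (tendsto_div_self hr h)
  rw [dslope_same, hd.deriv] at h1
  have h2 := (h.mul h1).const_mul (-((r : ℂ) * a)⁻¹)
  have h3 : -((r : ℂ) * a)⁻¹ * (a * -(r : ℂ)) = 1 := by field_simp
  rw [h3] at h2
  refine h2.congr' ?_
  filter_upwards [self_mem_nhdsWithin] with z hz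
  have hz : z ≠ 0 := hz
  have h4 := sub_smul_dslope φ 1 (f z / z)
  have h5 : (f z - z) / z ^ (r + 1) = (f z / z - 1) * (z ^ r)⁻¹ := by
    rw [pow_succ]
    field_simp
  rw [h5, Function.comp_apply, mul_right_comm (f z / z - 1),
    ← smul_eq_mul (f z / z - 1) (dslope _ _ _), h4]
  simp only [hφ, fatouCoord, one_pow, inv_one, div_pow, mul_inv, inv_div]
  field_simp
  ring

/-- Near `0`, the map `f` is close to the unit translation in the Fatou coordinate, and it
does not change the branch of the `r`-th root. -/
lemma eventually_translation (hr : r ≠ 0) (ha : a ≠ 0)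
    (h : Tendsto (fun z => (f z - z) / z ^ (r + 1)) (𝓝[≠] 0) (𝓝 a)) :
    ∀ᶠ z in 𝓝[≠] 0, f z ≠ 0 ∧ ‖fatouCoord a r (f z) - fatouCoord a r z - 1‖ ≤ 1 / 4 ∧
      |(((f z / z)⁻¹) ^ r).arg| < Real.pi / 4 ∧
      (((f z / z)⁻¹) ^ r) ^ ((r : ℂ)⁻¹) = (f z / z)⁻¹ := by
  have hm := tendsto_div_self hr h
  have hm' := hm.inv₀ one_ne_zero
  rw [inv_one] at hm'
  have harg : Tendsto (fun w : ℂ => w.arg) (𝓝 1) (𝓝 0) := by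
    simpa using (Complex.continuousAt_arg Complex.one_mem_slitPlane).tendsto
  have hp : Tendsto (fun w : ℂ => w ^ r) (𝓝 1) (𝓝 1) := by
    have : ContinuousAt (fun z : ℂ => z ^ r) 1 := by fun_prop
    simpa [ContinuousAt] using this
  have hpi := Real.pi_pos
  have hr0 : (0 : ℝ) < r := by positivity
  have h1 := (harg.comp (hp.comp hm')).abs.eventually_lt_const
    (show |(0 : ℝ)| < Real.pi / 4 by rw [abs_zero]; positivity)
  have h2 := (harg.comp hm').abs.eventually_lt_const
    (show |(0 : ℝ)| < Real.pi / r by rw [abs_zero]; positivity)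
  have h3 := ((tendsto_fatouCoord_sub hr ha h).sub_const 1).norm.eventually_le_const
    (show ‖(1 : ℂ) - 1‖ < 1 / 4 by norm_num)
  filter_upwards [h1, h2, h3, hm.eventually_ne one_ne_zero] with z h1 h2 h3 h4
  refine ⟨fun h0 => h4 (by simp [h0]), h3, h1, ?_⟩
  have := abs_lt.1 h2
  exact Complex.pow_cpow_nat_inv hr this.1 this.2.le

lemma fatouCoord_step {w w' : ℂ} (h : ‖w' - w - 1‖ ≤ 1 / 4) :
    w.re + 3 / 4 ≤ w'.re ∧ |w'.im - w.im| ≤ 1 / 4 := by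
  have h1 := (Complex.abs_re_le_norm _).trans h
  have h2 := (Complex.abs_im_le_norm _).trans h
  simp only [Complex.sub_re, Complex.sub_im, Complex.one_re, Complex.one_im, sub_zero] at h1 h2
  exact ⟨by linarith [(abs_le.1 h1).1], h2⟩

lemma mapsTo_petal (hr : r ≠ 0) (hR : 0 ≤ R) (hv : IsAttractingDir a r v)
    (h : ∀ z ∈ petal a r R v, f z ≠ 0 ∧
      ‖fatouCoord a r (f z) - fatouCoord a r z - 1‖ ≤ 1 / 4 ∧
      |(((f z / z)⁻¹) ^ r).arg| < Real.pi / 4 ∧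
      (((f z / z)⁻¹) ^ r) ^ ((r : ℂ)⁻¹) = (f z / z)⁻¹) :
    MapsTo f (petal a r R v) (petal a r R v) := by
  rintro z hz
  obtain ⟨h1, h2, h3, h4⟩ := h z hz
  obtain ⟨ζ, hζ, rfl⟩ := hz
  set z := petalMap a r v ζ with hzdef
  have hζ0 := ne_zero_of_mem_petalRegion hR hζ
  have hz0 : z ≠ 0 := petalMap_ne_zero hr hv hζ0
  have hfz : fatouCoord a r z = ζ := fatouCoord_petalMap hr hv
  refine mem_petal_of_arg hr hv h1 ?_ ?_
  · rw [hfz] at h2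
    obtain ⟨h5, h6⟩ := fatouCoord_step h2
    have h7 := abs_sub_abs_le_abs_sub ζ.im (fatouCoord a r (f z)).im
    rw [abs_sub_comm] at h7
    simp only [petalRegion, mem_ofPred_eq] at hζ ⊢
    linarith
  · have hu : ζ ^ ((r : ℂ)⁻¹) ≠ 0 := by simp [Complex.cpow_eq_zero_iff, hζ0]
    have hvc : v * petalScale a r / f z = ζ ^ ((r : ℂ)⁻¹) * (f z / z)⁻¹ := by
      have : v * petalScale a r = z * ζ ^ ((r : ℂ)⁻¹) := by
        rw [hzdef, petalMap, div_mul_cancel₀ _ hu]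
      rw [this, inv_div]
      ring
    have hm0 : ((f z / z)⁻¹) ^ r ≠ 0 := pow_ne_zero _ (inv_ne_zero (div_ne_zero h1 hz0))
    rw [hvc, mul_pow, Complex.cpow_nat_inv_pow _ hr]
    conv_rhs => rw [← h4]
    rw [Complex.cpow_def_of_ne_zero (mul_ne_zero hζ0 hm0), Complex.cpow_def_of_ne_zero hζ0,
      Complex.cpow_def_of_ne_zero hm0, ← Complex.exp_add, ← add_mul, Complex.log_mul hζ0 hm0]
    have h5 := abs_lt.1 (abs_arg_lt_of_mem_petalRegion hR hζ)
    have h6 := abs_lt.1 h3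
    constructor <;> linarith [h5.1, h5.2, h6.1, h6.2]

lemma petalMap_ofReal_mul {t : ℝ} (ht : 0 < t) (ζ : ℂ) :
    petalMap a r v (t * ζ) / ‖petalMap a r v (t * ζ)‖ =
      petalMap a r v ζ / ‖petalMap a r v ζ‖ := by
  rcases eq_or_ne ζ 0 with rfl | hζ
  · simp
  have ht0 : (t : ℂ) ≠ 0 := by exact_mod_cast ht.ne'
  set s : ℝ := t ^ ((r : ℝ)⁻¹) with hs
  have hs0 : 0 < s := by positivity
  have h1 : (t * ζ) ^ ((r : ℂ)⁻¹) = s * ζ ^ ((r : ℂ)⁻¹) := by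
    rw [Complex.cpow_def_of_ne_zero (mul_ne_zero ht0 hζ), Complex.log_ofReal_mul ht hζ, add_mul,
      Complex.exp_add, Complex.cpow_def_of_ne_zero hζ, hs, Complex.ofReal_cpow ht.le,
      Complex.cpow_def_of_ne_zero ht0, Complex.ofReal_log ht.le]
    simp
  have h2 : petalMap a r v (t * ζ) = (s⁻¹ : ℝ) * petalMap a r v ζ := by
    rw [petalMap, h1, petalMap, Complex.ofReal_inv]
    ring
  have h3 : ((s⁻¹ : ℝ) : ℂ) ≠ 0 := by exact_mod_cast (inv_pos.2 hs0).ne'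
  rw [h2, norm_mul, Complex.norm_real, Real.norm_of_nonneg (inv_pos.2 hs0).le, Complex.ofReal_mul,
    mul_div_mul_left _ _ h3]

/-- Orbits staying in a small petal tend to `0` tangentially to its direction. -/
lemma tendsto_of_forall_mem_petal (hr : r ≠ 0) (hR : 0 ≤ R) (hv : IsAttractingDir a r v)
    (hf : Tendsto (fun z => (f z - z) / z ^ (r + 1)) (𝓝[≠] 0) (𝓝 a)) {x : ℕ → ℂ}
    (hx : ∀ k, x (k + 1) = f (x k)) (hmem : ∀ k, x k ∈ petal a r R v)
    (h : ∀ z ∈ petal a r R v, ‖fatouCoord a r (f z) - fatouCoord a r z - 1‖ ≤ 1 / 4) :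
    Tendsto x atTop (𝓝 0) ∧ Tendsto (fun k => x k / (‖x k‖ : ℂ)) atTop (𝓝 v) := by
  obtain ⟨hv1, -, ha⟩ := isAttractingDir_iff.1 hv
  choose w hw hwx using hmem
  have hcoord : ∀ k, fatouCoord a r (x k) = w k := fun k => by
    rw [← hwx, fatouCoord_petalMap hr hv]
  have hx0 : ∀ k, x k ≠ 0 := fun k => by
    rw [← hwx]
    exact petalMap_ne_zero hr hv (ne_zero_of_mem_petalRegion hR (hw k))
  have hstep : ∀ k, (w k).re + 3 / 4 ≤ (w (k + 1)).re := fun k => by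
    have := (fatouCoord_step (h (x k) (hwx k ▸ mem_image_of_mem _ (hw k)))).1
    rwa [← hx, hcoord, hcoord] at this
  have hlow : ∀ k : ℕ, (w 0).re + 3 / 4 * k ≤ (w k).re := fun k => by
    induction k with
    | zero => simp
    | succ k ih =>
      push_cast
      linarith [hstep k]
  have hcob : Tendsto w atTop (Bornology.cobounded ℂ) := by
    rw [← tendsto_norm_atTop_iff_cobounded]
    refine tendsto_atTop_mono (fun k => (hlow k).trans ((le_abs_self _).trans
      (Complex.abs_re_le_norm _))) ?_
    exact tendsto_atTop_add_const_left _ _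
      (tendsto_natCast_atTop_atTop.const_mul_atTop (by norm_num))
  have hx_tendsto : Tendsto x atTop (𝓝 0) :=
    ((tendsto_petalMap_cobounded hr hv1).comp hcob).congr hwx
  refine ⟨hx_tendsto, ?_⟩
  have hx_ne : Tendsto x atTop (𝓝[≠] 0) :=
    tendsto_nhdsWithin_iff.2 ⟨hx_tendsto, Eventually.of_forall hx0⟩
  have hdiff : Tendsto (fun k => w (k + 1) - w k) atTop (𝓝 1) := by
    refine ((tendsto_fatouCoord_sub hr ha hf).comp hx_ne).congr fun k => ?_
    simp only [Function.comp_apply, ← hx, hcoord]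
  have hces := hdiff.cesaro_smul
  simp only [Finset.sum_range_sub] at hces
  have hinv : Tendsto (fun n : ℕ => (n⁻¹ : ℝ) • w 0) atTop (𝓝 0) := by
    simpa using (tendsto_inv_atTop_nhds_zero_nat (𝕜 := ℝ)).smul_const (w 0)
  have hlin : Tendsto (fun n : ℕ => (n⁻¹ : ℝ) • w n) atTop (𝓝 1) := by
    simpa [smul_sub] using hces.add hinv
  have hcont : ContinuousAt (petalMap a r v) 1 :=
    petalMap_continuousAt Complex.one_mem_slitPlane
  have hone := petalMap_ne_zero (a := a) hr hv one_ne_zero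
  have hdir := (hcont.tendsto.comp hlin).div
    (Complex.continuous_ofReal.tendsto _ |>.comp (hcont.tendsto.comp hlin).norm)
    (by simpa using hone)
  have hlim : petalMap a r v 1 / (‖petalMap a r v 1‖ : ℂ) = v := by
    have hc := petalScale_pos hr ha
    have hc0 : (petalScale a r : ℂ) ≠ 0 := by exact_mod_cast hc.ne'
    simp [petalMap, hv1, abs_of_pos hc, hc0]
  rw [hlim] at hdir
  refine hdir.congr' ?_
  filter_upwards [eventually_gt_atTop 0] with n hn
  have hn' : (0 : ℝ) < (n : ℝ)⁻¹ := by positivity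
  simp only [Pi.div_apply, Function.comp_apply, Complex.real_smul]
  rw [petalMap_ofReal_mul hn', hwx]

/-- A sequence tending to `0` tangentially to an attracting direction eventually lies in the
petal around it. -/
lemma eventually_mem_petal (hr : r ≠ 0) (hv : IsAttractingDir a r v) {x : ℕ → ℂ}
    (hx : Tendsto x atTop (𝓝 0)) (hxv : Tendsto (fun k => x k / (‖x k‖ : ℂ)) atTop (𝓝 v)) :
    ∀ᶠ k in atTop, x k ∈ petal a r R v := by
  obtain ⟨hv1, hv2, ha⟩ := isAttractingDir_iff.1 hv
  have hv0 : v ≠ 0 := norm_ne_zero_iff.1 (by rw [hv1]; exact one_ne_zero)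
  have hr' : (r : ℂ) ≠ 0 := by simpa using hr
  have hc := petalScale_pos hr ha
  have hx0 : ∀ᶠ k in atTop, x k ≠ 0 := by
    filter_upwards [hxv.eventually_ne hv0] with k hk h0
    simp [h0] at hk
  have he : Tendsto (fun k => v / (x k / (‖x k‖ : ℂ))) atTop (𝓝 1) := by
    have := (tendsto_const_nhds (x := v)).div hxv hv0
    rw [div_self hv0] at this
    exact this
  have harg : Tendsto (fun w : ℂ => w.arg) (𝓝 1) (𝓝 0) := by
    simpa using (Complex.continuousAt_arg Complex.one_mem_slitPlane).tendsto
  have hp : Tendsto (fun w : ℂ => (w ^ r).re) (𝓝 1) (𝓝 1) := by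
    have : ContinuousAt (fun z : ℂ => (z ^ r).re) 1 := by fun_prop
    simpa [ContinuousAt] using this
  have hpi : 0 < Real.pi / r := by positivity
  have h1 := (harg.comp he).abs.eventually_lt_const
    (show |(0 : ℝ)| < Real.pi / r by rw [abs_zero]; exact hpi)
  have hnorm : Tendsto (fun k => (petalScale a r / ‖x k‖) ^ r) atTop atTop := by
    refine (tendsto_pow_atTop hr).comp
      (Tendsto.const_mul_atTop hc (Tendsto.inv_tendsto_nhdsGT_zero ?_))
    rw [tendsto_nhdsWithin_iff]
    refine ⟨by simpa using hx.norm, ?_⟩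
    filter_upwards [hx0] with k hk using norm_pos_iff.2 hk
  have hbig := (hnorm.atTop_mul_pos one_pos (hp.comp he)).eventually_gt_atTop R
  filter_upwards [h1, hx0, hbig] with k h1 hk hbig
  have hn : (‖x k‖ : ℂ) ≠ 0 := by simpa using hk
  have hn' : 0 < ‖x k‖ := norm_pos_iff.2 hk
  have hq : v * petalScale a r / x k =
      ((petalScale a r / ‖x k‖ : ℝ) : ℂ) * (v / (x k / (‖x k‖ : ℂ))) := by
    push_cast
    field_simp
  have hcoord : fatouCoord a r (x k) = (v * petalScale a r / x k) ^ r := by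
    have hcr : (petalScale a r : ℂ) ^ r = ((r : ℂ) * (‖a‖ : ℂ))⁻¹ := by
      exact_mod_cast congrArg ((↑) : ℝ → ℂ) (petalScale_pow (a := a) hr)
    have ha' : (‖a‖ : ℂ) ≠ 0 := by simpa using ha
    have : v ^ r = -‖a‖ / a := by rw [eq_div_iff ha, ← hv2, mul_comm]
    rw [fatouCoord, div_pow, mul_pow, hcr, this]
    field_simp
  refine mem_petal_of_arg hr hv hk ?_ ?_
  · rw [hcoord, hq, mul_pow, ← Complex.ofReal_pow]
    simp only [petalRegion, mem_ofPred_eq, Complex.re_ofReal_mul]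
    have := abs_nonneg
      (((((petalScale a r / ‖x k‖) ^ r : ℝ) : ℂ) * (v / (x k / (‖x k‖ : ℂ))) ^ r).im)
    simp only [Function.comp_apply] at hbig
    linarith
  · have h2 := abs_lt.1 h1
    have h3 : (v * petalScale a r / x k).arg = (v / (x k / (‖x k‖ : ℂ))).arg := by
      rw [hq, Complex.arg_real_mul _ (by positivity)]
    exact Complex.pow_cpow_nat_inv hr (h3 ▸ h2.1) (h3 ▸ h2.2.le)

lemma isAttractingPetal_petal (hr : r ≠ 0) {U : Set ℂ} (hU : U ∈ 𝓝 0) (ha : a ≠ 0)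
    (hf : Tendsto (fun z => (f z - z) / z ^ (r + 1)) (𝓝[≠] 0) (𝓝 a)) :
    ∀ᶠ R in atTop, ∀ v, IsAttractingDir a r v → IsAttractingPetal f U v (petal a r R v) := by
  have hgood := eventually_nhdsWithin_iff.1 (eventually_translation hr ha hf)
  filter_upwards [eventually_petal_subset (a := a) hr (inter_mem hU hgood), eventually_ge_atTop 0]
    with R hsub hR v hv
  replace hsub := hsub v hv.1
  have h0 : ∀ z ∈ petal a r R v, z ≠ 0 := by
    rintro _ ⟨ζ, hζ, rfl⟩
    exact petalMap_ne_zero hr hv (ne_zero_of_mem_petalRegion hR hζ)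
  have hg := fun z hz => (hsub hz).2 (h0 z hz)
  have hmaps := mapsTo_petal hr hR hv hg
  refine ⟨isOpen_petal hr hR hv, simplyConnectedSpace_petal hr hR hv, hmaps,
    fun z hz => ⟨fun k => (hsub (hmaps.iterate k hz)).1, h0 z hz⟩, ?_⟩
  rintro z ⟨hz, hz0⟩
  constructor
  · rintro ⟨-, -, h1, h2⟩
    exact (eventually_mem_petal hr hv h1 h2).exists
  · rintro ⟨k, hk⟩
    obtain ⟨h1, h2⟩ := tendsto_of_forall_mem_petal hr hR hv hf (x := fun n => f^[n + k] z)
      (fun n => by rw [add_right_comm, Function.iterate_succ_apply'])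
      (fun n => by
        rw [Function.iterate_add_apply]
        exact hmaps.iterate n hk)
      (fun z hz => (hg z hz).2.1)
    exact ⟨hz, hz0, (tendsto_add_atTop_iff_nat k).1 h1,
      (tendsto_add_atTop_iff_nat (f := fun n => f^[n] z / (‖f^[n] z‖ : ℂ)) k).1 h2⟩

end Dynamics

section LocalInverse

variable {f : ℂ → ℂ} {r : ℕ}

lemma tendsto_sub_self_div_pow (hr : 1 ≤ r) (hf : AnalyticAt ℂ f 0) (hf0 : f 0 = 0)
    (hd1 : deriv f 0 = 1) (hvanish : ∀ k, 2 ≤ k → k ≤ r → iteratedDeriv k f 0 = 0) :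
    Tendsto (fun z => (f z - z) / z ^ (r + 1)) (𝓝[≠] 0)
      (𝓝 (iteratedDeriv (r + 1) f 0 / (Nat.factorial (r + 1) : ℂ))) := by
  set a := iteratedDeriv (r + 1) f 0 / (Nat.factorial (r + 1) : ℂ) with ha
  have hO := hf.hasFPowerSeriesAt.isBigO_sub_partialSum_pow (r + 2)
  have hsum : ∀ z : ℂ, (FormalMultilinearSeries.ofScalars ℂ
      (fun n ↦ iteratedDeriv n f 0 / n.factorial)).partialSum (r + 2) z = z + a * z ^ (r + 1) := by
    intro z
    simp only [FormalMultilinearSeries.partialSum, FormalMultilinearSeries.ofScalars_apply_eq,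
      smul_eq_mul]
    rw [Finset.sum_range_succ, Finset.sum_eq_single_of_mem 1 (by simp; omega)]
    · simp [hd1, ha]
    · intro k hk hk1
      rcases Nat.eq_zero_or_pos k with rfl | hk0
      · simp [hf0]
      · rw [hvanish k (by omega) (by have := Finset.mem_range.1 hk; omega)]
        simp
  simp only [hsum, zero_add] at hO
  have hO' : (fun z => f z - (z + a * z ^ (r + 1))) =o[𝓝 0] fun z : ℂ => z ^ (r + 1) := by
    refine hO.trans_isLittleO ?_
    simp_rw [← norm_pow]
    exact Asymptotics.IsLittleO.norm_left (Asymptotics.isLittleO_pow_pow (by omega))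
  have h1 := (hO'.mono nhdsWithin_le_nhds).tendsto_div_nhds_zero (l := 𝓝[≠] 0)
  have h2 := h1.add_const a
  rw [zero_add] at h2
  refine h2.congr' ?_
  filter_upwards [self_mem_nhdsWithin] with z hz
  have hz : z ≠ 0 := hz
  field_simp
  ring

lemma tendsto_inverse_sub_self_div_pow {g : ℂ → ℂ} {a : ℂ}
    (hf : Tendsto (fun z => (f z - z) / z ^ (r + 1)) (𝓝[≠] 0) (𝓝 a)) (hf0 : f 0 = 0)
    (hg : HasDerivAt g 1 0) (hg0 : g 0 = 0) (hfg : ∀ᶠ z in 𝓝 0, f (g z) = z) :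
    Tendsto (fun z => (g z - z) / z ^ (r + 1)) (𝓝[≠] 0) (𝓝 (-a)) := by
  have hne : ∀ᶠ z in 𝓝[≠] 0, g z ≠ 0 := by
    filter_upwards [self_mem_nhdsWithin, hfg.filter_mono nhdsWithin_le_nhds] with z hz hz' h0
    rw [h0, hf0] at hz'
    exact hz hz'.symm
  have hgt : Tendsto g (𝓝[≠] 0) (𝓝[≠] 0) := by
    refine tendsto_nhdsWithin_iff.2 ⟨?_, hne⟩
    have := hg.continuousAt.tendsto
    rw [hg0] at this
    exact this.mono_left nhdsWithin_le_nhds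
  have hq : Tendsto (fun z => g z / z) (𝓝[≠] 0) (𝓝 1) := by
    refine (hasDerivAt_iff_tendsto_slope.1 hg).congr fun z => ?_
    simp [slope_def_field, hg0]
  have h := ((hf.comp hgt).mul (hq.pow (r + 1))).neg
  rw [one_pow, mul_one] at h
  refine h.congr' ?_
  filter_upwards [hne, self_mem_nhdsWithin, hfg.filter_mono nhdsWithin_le_nhds] with z hz hz0 hz'
  have hz0 : z ≠ 0 := hz0
  simp only [Function.comp_apply, hz', div_pow]
  field_simp
  ring

lemma exists_local_inverse {U : Set ℂ} (hU : U ∈ 𝓝 0) (hf : AnalyticAt ℂ f 0) (hf0 : f 0 = 0)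
    (hd1 : deriv f 0 = 1) :
    ∃ (g : ℂ → ℂ) (V : Set ℂ), IsOpen V ∧ (0 : ℂ) ∈ V ∧ V ⊆ U ∧ g 0 = 0 ∧
      DifferentiableOn ℂ g V ∧ MapsTo g V U ∧ (∀ z ∈ V, f (g z) = z) ∧ HasDerivAt g 1 0 := by
  have hd : deriv f 0 ≠ 0 := by simp [hd1]
  have hg := hf.analyticAt_localInverse hd
  have hg1 := (hf.hasStrictDerivAt.to_localInverse hd).hasDerivAt
  have hfg := hf.hasStrictDerivAt.eventually_right_inverse hd
  have hg0 : hf.hasStrictDerivAt.localInverse f (deriv f 0) 0 hd (f 0) = 0 :=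
    HasStrictFDerivAt.localInverse_apply_image ..
  set g := hf.hasStrictDerivAt.localInverse f (deriv f 0) 0 hd
  rw [hf0] at hg hg1 hfg hg0
  rw [hd1, inv_one] at hg1
  have hgU : ∀ᶠ z in 𝓝 0, g z ∈ U := hg.continuousAt.eventually_mem (by rwa [hg0])
  have hgd : ∀ᶠ z in 𝓝 0, DifferentiableAt ℂ g z :=
    hg.eventually_analyticAt.mono fun z hz => hz.differentiableAt
  obtain ⟨V, hV, hVo, hV0⟩ := eventually_nhds_iff.1 (hfg.and (hgU.and (hgd.and hU)))
  exact ⟨g, V, hVo, hV0, fun z hz => (hV z hz).2.2.2, hg0,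
    fun z hz => (hV z hz).2.2.1.differentiableWithinAt, fun z hz => (hV z hz).2.1,
    fun z hz => (hV z hz).1, hg1⟩

end LocalInverse

/-- In the Fatou coordinate, an orbit of almost-translations eventually leaves every
sector to the left. -/
lemma exists_lt_re_sub_abs_im {w : ℕ → ℂ} (h : ∀ k, ‖w (k + 1) - w k - 1‖ ≤ 1 / 4) (M : ℝ) :
    ∃ k, M < (w k).re - |(w k).im| := by
  have hlow : ∀ k : ℕ, (w 0).re - |(w 0).im| + k / 2 ≤ (w k).re - |(w k).im| := fun k => by
    induction k with
    | zero => simp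
    | succ k ih =>
      obtain ⟨h1, h2⟩ := fatouCoord_step (h k)
      have h3 := abs_sub_abs_le_abs_sub (w (k + 1)).im (w k).im
      push_cast
      linarith
  obtain ⟨k, hk⟩ := exists_nat_gt (2 * (M - ((w 0).re - |(w 0).im|)))
  exact ⟨k, by linarith [hlow k]⟩

lemma exists_iterate_mem_attracting_petal {f : ℂ → ℂ} {a : ℂ} {r : ℕ} {R : ℝ} {N : Set ℂ}
    (hr : r ≠ 0)
    (hN : N ⊆ insert (0 : ℂ) ((⋃ v ∈ {v | IsAttractingDir a r v}, petal a r R v) ∪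
      ⋃ v ∈ {v | IsRepellingDir a r v}, petal (-a) r R v))
    (hf : ∀ z ∈ N, z ≠ 0 → f z ≠ 0 ∧ ‖fatouCoord a r (f z) - fatouCoord a r z - 1‖ ≤ 1 / 4)
    {z : ℂ} (hz : z ∈ stableSet f N) (hz0 : z ≠ 0) :
    ∃ v, IsAttractingDir a r v ∧ ∃ k, f^[k] z ∈ petal a r R v := by
  have hne : ∀ k, f^[k] z ≠ 0 := fun k => by
    induction k with
    | zero => exact hz0
    | succ k ih =>
      rw [Function.iterate_succ_apply']
      exact (hf _ (hz k) ih).1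
  obtain ⟨k, hk⟩ := exists_lt_re_sub_abs_im (w := fun k => fatouCoord a r (f^[k] z)) (fun k => by
    rw [Function.iterate_succ_apply']
    exact (hf _ (hz k) (hne k)).2) (-R)
  rcases hN (hz k) with h | h | h
  · exact absurd h (hne k)
  · obtain ⟨v, hv, h⟩ := mem_iUnion₂.1 h
    exact ⟨v, hv, k, h⟩
  · obtain ⟨v, hv, ζ, hζ, h⟩ := mem_iUnion₂.1 h
    have h1 := fatouCoord_petalMap (ζ := ζ) hr (isRepellingDir_iff.1 hv)
    rw [h, fatouCoord_neg, neg_eq_iff_eq_neg] at h1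
    simp only [petalRegion, mem_ofPred_eq] at hζ
    simp only [h1, Complex.neg_re, Complex.neg_im, abs_neg] at hk
    linarith

lemma union_petals_mem_nhds {a : ℂ} {r : ℕ} (R : ℝ) (hr : r ≠ 0) (ha : a ≠ 0) :
    insert (0 : ℂ) ((⋃ v ∈ {v | IsAttractingDir a r v}, petal a r R v) ∪
      ⋃ v ∈ {v | IsRepellingDir a r v}, petal (-a) r R v) ∈ 𝓝 0 := by
  have h : Tendsto (fun z => ‖fatouCoord a r z‖) (𝓝[≠] 0) atTop := by
    have h0 : Tendsto (fun z : ℂ => (r : ℂ) * a * z ^ r) (𝓝[≠] 0) (𝓝[≠] 0) := by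
      refine tendsto_nhdsWithin_iff.2 ⟨?_, ?_⟩
      · have : ContinuousAt (fun z : ℂ => (r : ℂ) * a * z ^ r) 0 := by fun_prop
        simpa [ContinuousAt, hr] using this.tendsto.mono_left nhdsWithin_le_nhds
      · filter_upwards [self_mem_nhdsWithin] with z hz
        have hz : z ≠ 0 := hz
        simp [hr, ha, hz]
    simp only [fatouCoord, norm_neg]
    exact tendsto_norm_cobounded_atTop.comp (tendsto_inv₀_nhdsNE_zero.comp h0)
  filter_upwards [eventually_nhdsWithin_iff.1 (h.eventually_gt_atTop R)] with z hz
  rcases eq_or_ne z 0 with rfl | hz0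
  · exact mem_insert _ _
  refine mem_insert_of_mem _ ?_
  have h1 := (hz hz0).trans_le (Complex.norm_le_abs_re_add_abs_im _)
  rcases le_total 0 (fatouCoord a r z).re with hre | hre
  · rw [abs_of_nonneg hre] at h1
    obtain ⟨v, hv, hm⟩ := exists_mem_petal hr ha hz0 h1
    exact Or.inl (mem_biUnion hv hm)
  · rw [abs_of_nonpos hre] at h1
    obtain ⟨v, hv, hm⟩ := exists_mem_petal (a := -a) (R := R) hr (neg_ne_zero.2 ha) hz0 (by
      simpa [fatouCoord_neg, petalRegion] using h1)
    exact Or.inr (mem_biUnion (isRepellingDir_iff.2 hv) hm)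

end LeauFatou

/-- **Leau–Fatou flower theorem, parts (i) and (ii).** Let `f` be a holomorphic local dynamical
system at `0 ∈ ℂ` tangent to the identity with multiplicity `r+1 ≥ 2`, and let
`a = a_{r+1} = f^{(r+1)}(0)/(r+1)!` be its leading coefficient. Then each of the `r` attracting
directions has an attracting petal, each of the `r` repelling directions has a repelling petal
(an attracting petal for a local inverse `g` of `f`), the union `N` of these `2r` petals
together with the origin is a neighbourhood of the origin, and the stable set (relative to `N`)
minus the origin is the disjoint union of the basins centered at the attracting directions. -/
theorem leau_fatou_flower
    (f : ℂ → ℂ) (U : Set ℂ) (hU : IsOpen U) (h0 : (0 : ℂ) ∈ U)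
    (hf : DifferentiableOn ℂ f U) (hf0 : f 0 = 0) (r : ℕ) (hr : 1 ≤ r)
    (hd1 : deriv f 0 = 1)
    (hvanish : ∀ k, 2 ≤ k → k ≤ r → iteratedDeriv k f 0 = 0)
    (hlead : iteratedDeriv (r + 1) f 0 ≠ 0)
    (a : ℂ) (ha : a = iteratedDeriv (r + 1) f 0 / (Nat.factorial (r + 1) : ℂ)) :
    ∃ (P Q : ℂ → Set ℂ) (g : ℂ → ℂ) (V : Set ℂ) (N : Set ℂ),
      -- `g` is a local inverse of `f` defined on the open neighbourhood `V` of the origin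
      IsOpen V ∧ (0 : ℂ) ∈ V ∧ V ⊆ U ∧ g 0 = 0 ∧ DifferentiableOn ℂ g V ∧
      Set.MapsTo g V U ∧ (∀ z ∈ V, f (g z) = z) ∧
      -- (i): attracting and repelling petals
      (∀ v, IsAttractingDir a r v → IsAttractingPetal f U v (P v)) ∧
      (∀ v, IsRepellingDir a r v → IsAttractingPetal g V v (Q v)) ∧
      N = insert (0 : ℂ)
        ((⋃ v ∈ {v | IsAttractingDir a r v}, P v) ∪ ⋃ v ∈ {v | IsRepellingDir a r v}, Q v) ∧
      N ∈ 𝓝 (0 : ℂ) ∧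
      -- (ii): the stable set relative to `N`, minus the origin, is the disjoint union of the
      -- basins centered at the attracting directions
      stableSet f N \ {0} = (⋃ v ∈ {v | IsAttractingDir a r v}, basin f N v) ∧
      (∀ v w, IsAttractingDir a r v → IsAttractingDir a r w → v ≠ w →
        Disjoint (basin f N v) (basin f N w)) := by
  have hr0 : r ≠ 0 := by omega
  have hUn : U ∈ 𝓝 (0 : ℂ) := hU.mem_nhds h0
  have hfa : AnalyticAt ℂ f 0 := hf.analyticAt hUn
  have ha0 : a ≠ 0 := ha ▸ div_ne_zero hlead (Nat.cast_ne_zero.2 (Nat.factorial_ne_zero _))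
  have hft := LeauFatou.tendsto_sub_self_div_pow hr hfa hf0 hd1 hvanish
  rw [← ha] at hft
  obtain ⟨g, V, hV, hV0, hVU, hg0, hgd, hgm, hfg, hg1⟩ :=
    LeauFatou.exists_local_inverse hUn hfa hf0 hd1
  have hVn : V ∈ 𝓝 (0 : ℂ) := hV.mem_nhds hV0
  have hgt := LeauFatou.tendsto_inverse_sub_self_div_pow hft hf0 hg1 hg0
    (Filter.mem_of_superset hVn hfg)
  obtain ⟨W, hW, hgood⟩ := (eventually_nhdsWithin_iff.1
    (LeauFatou.eventually_translation hr0 ha0 hft)).exists_mem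
  obtain ⟨R, hP, hQ, hPsub, hQsub⟩ := ((LeauFatou.isAttractingPetal_petal hr0 hUn ha0 hft).and
    ((LeauFatou.isAttractingPetal_petal hr0 hVn (neg_ne_zero.2 ha0) hgt).and
    ((LeauFatou.eventually_petal_subset (a := a) hr0 (inter_mem hUn hW)).and
    (LeauFatou.eventually_petal_subset (a := -a) hr0 (inter_mem hUn hW))))).exists
  set N := insert (0 : ℂ) ((⋃ v ∈ {v | IsAttractingDir a r v}, LeauFatou.petal a r R v) ∪
    ⋃ v ∈ {v | IsRepellingDir a r v}, LeauFatou.petal (-a) r R v) with hN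
  have hNsub : ∀ z ∈ N, z ≠ 0 → z ∈ U ∩ W := by
    rintro z (rfl | hz | hz) hz0
    · exact absurd rfl hz0
    · obtain ⟨v, hv, hz⟩ := mem_iUnion₂.1 hz
      exact hPsub v hv.1 hz
    · obtain ⟨v, hv, hz⟩ := mem_iUnion₂.1 hz
      exact hQsub v hv.1 hz
  have hNU : N ⊆ U := fun z hz => by
    rcases eq_or_ne z 0 with rfl | hz0
    · exact h0
    · exact (hNsub z hz hz0).1
  refine ⟨LeauFatou.petal a r R, LeauFatou.petal (-a) r R, g, V, N, hV, hV0, hVU, hg0, hgd, hgm,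
    hfg, hP, fun v hv => hQ v (LeauFatou.isRepellingDir_iff.1 hv), hN,
    LeauFatou.union_petals_mem_nhds R hr0 ha0, ?_, ?_⟩
  · ext z
    simp only [mem_iUnion₂]
    constructor
    · rintro ⟨hz, hz0⟩
      obtain ⟨v, hv, hk⟩ := LeauFatou.exists_iterate_mem_attracting_petal hr0 hN.subset
        (fun z hz hz0 => by
          have := hgood z (hNsub z hz hz0).2 hz0
          exact ⟨this.1, this.2.1⟩) hz hz0
      obtain ⟨-, -, h1, h2⟩ := ((hP v hv).2.2.2.2 z ⟨fun k => hNU (hz k), hz0⟩).2 hk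
      exact ⟨v, hv, hz, hz0, h1, h2⟩
    · rintro ⟨v, -, hz, hz0, -, -⟩
      exact ⟨hz, hz0⟩
  · intro v w _ _ hvw
    rw [Set.disjoint_left]
    rintro z ⟨-, -, -, h1⟩ ⟨-, -, -, h2⟩
    exact hvw (tendsto_nhds_unique h1 h2)
end
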